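/- For every (t,j) ∈ A, the inequality x_{1,j,t} ≤ y_{t,t,j} is facet-defining for Ptt(n). -/

import Mathlib

open Finset

attribute [local instance] Classical.propDecidable

namespace TTP

/-- `(k,i,j)` is a valid match index: slot `k ∈ S = {1,…,2n-2}`, home venue `i` and
away team `j` are distinct elements of `V = {1,…,n}`. -/
def IsMatch (n : ℕ) (m : ℕ × ℕ × ℕ) : Prop :=
  1 ≤ m.1 ∧ m.1 ≤ 2 * n - 2 ∧ 1 ≤ m.2.1 ∧ m.2.1 ≤ n ∧ 1 ≤ m.2.2 ∧ m.2.2 ≤ n ∧ m.2.1 ≠ m.2.2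

/-- `(t,i,j)` is a valid travel index: `t ∈ V` and `(i,j) ∈ A`. -/
def IsTravelIdx (n : ℕ) (p : ℕ × ℕ × ℕ) : Prop :=
  1 ≤ p.1 ∧ p.1 ≤ n ∧ 1 ≤ p.2.1 ∧ p.2.1 ≤ n ∧ 1 ≤ p.2.2 ∧ p.2.2 ≤ n ∧ p.2.1 ≠ p.2.2

/-- A (double round-robin) tournament: a set of matches such that in every slot every team
plays exactly once, and every ordered pair of distinct teams meets exactly once. -/
structure IsTournament (n : ℕ) (T : Set (ℕ × ℕ × ℕ)) : Prop where
  subset : ∀ m ∈ T, IsMatch n m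
  slot_team : ∀ k, 1 ≤ k → k ≤ 2 * n - 2 → ∀ t, 1 ≤ t → t ≤ n →
      ∃! m : ℕ × ℕ × ℕ, m ∈ T ∧ m.1 = k ∧ (t = m.2.1 ∨ t = m.2.2)
  pair : ∀ i j, 1 ≤ i → i ≤ n → 1 ≤ j → j ≤ n → i ≠ j → ∃! k : ℕ, (k, i, j) ∈ T

/-- The venue of team `t` in slot `k`: the home venue of the (unique) match of `t` in
slot `k`, and `t` itself if `t` has no match in slot `k` (in particular in the artificial
slots `0` and `2n-1`). -/
noncomputable def venue (T : Set (ℕ × ℕ × ℕ)) (t k : ℕ) : ℕ :=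
  if h : ∃ i, ∃ j, (k, i, j) ∈ T ∧ (t = i ∨ t = j) then h.choose else t

/-- The travel vector `ψ(T)`: `travel n T (t,i,j) = 1` iff for some `0 ≤ k ≤ 2n-2` team `t`
has venue `i` in slot `k` and venue `j` in slot `k+1`. -/
noncomputable def travel (n : ℕ) (T : Set (ℕ × ℕ × ℕ)) (p : ℕ × ℕ × ℕ) : ℝ :=
  if ∃ k, k ≤ 2 * n - 2 ∧ venue T p.1 k = p.2.1 ∧ venue T p.1 (k + 1) = p.2.2 then 1 else 0

/-- The play vector `χ(T)`: characteristic vector of `T`. -/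
noncomputable def play (T : Set (ℕ × ℕ × ℕ)) (m : ℕ × ℕ × ℕ) : ℝ :=
  if m ∈ T then 1 else 0

/-- The ambient space `ℝ^M × ℝ^{V×A}`. -/
abbrev Pt (n : ℕ) :=
  ({m : ℕ × ℕ × ℕ // IsMatch n m} → ℝ) × ({p : ℕ × ℕ × ℕ // IsTravelIdx n p} → ℝ)

/-- The play coordinate `x_{k,i,j}` of a point (0 at invalid indices). -/
noncomputable def xval {n : ℕ} (z : Pt n) (k i j : ℕ) : ℝ :=
  if h : IsMatch n (k, i, j) then z.1 ⟨(k, i, j), h⟩ else 0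

/-- The travel coordinate `y_{t,i,j}` of a point (0 at invalid indices). -/
noncomputable def yval {n : ℕ} (z : Pt n) (t i j : ℕ) : ℝ :=
  if h : IsTravelIdx n (t, i, j) then z.2 ⟨(t, i, j), h⟩ else 0

/-- The unconstrained traveling tournament polytope `Ptt(n)`:
the convex hull of all pairs `(χ(T), y)` with `T` a tournament and `y ∈ {0,1}^{V×A}`,
`y ≥ ψ(T)` componentwise. -/
def Ptt (n : ℕ) : Set (Pt n) :=
  convexHull ℝ { z : Pt n | ∃ T : Set (ℕ × ℕ × ℕ), IsTournament n T ∧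
    (∀ m : {m : ℕ × ℕ × ℕ // IsMatch n m}, z.1 m = play T m.1) ∧
    (∀ p : {p : ℕ × ℕ × ℕ // IsTravelIdx n p}, z.2 p = 0 ∨ z.2 p = 1) ∧
    (∀ p : {p : ℕ × ℕ × ℕ // IsTravelIdx n p}, travel n T p.1 ≤ z.2 p) }

/-- Dimension of the affine hull of a set. -/
noncomputable def adim {n : ℕ} (s : Set (Pt n)) : ℕ :=
  Module.finrank ℝ (affineSpan ℝ s).direction

/-- A valid inequality `f z ≤ γ` is facet-defining for `Ptt(n)`:
it holds on `Ptt(n)` and its face has dimension `dim Ptt(n) - 1`. -/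
def IsFacetLE {n : ℕ} (f : Pt n → ℝ) (γ : ℝ) : Prop :=
  (∀ z ∈ Ptt n, f z ≤ γ) ∧ adim {z ∈ Ptt n | f z = γ} + 1 = adim (Ptt n)

/-- A valid inequality `f z ≥ γ` is facet-defining for `Ptt(n)`:
it holds on `Ptt(n)` and its face has dimension `dim Ptt(n) - 1`. -/
def IsFacetGE {n : ℕ} (f : Pt n → ℝ) (γ : ℝ) : Prop :=
  (∀ z ∈ Ptt n, γ ≤ f z) ∧ adim {z ∈ Ptt n | f z = γ} + 1 = adim (Ptt n)


/-- A slot function on ordered pairs of distinct teams describing a tournament: different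
ordered pairs that share a team get different slots. -/
structure Sched (n : ℕ) (τ : ℕ → ℕ → ℕ) : Prop where
  range : ∀ x ∈ Icc 1 n, ∀ y ∈ Icc 1 n, x ≠ y → τ x y ∈ Icc 1 (2 * n - 2)
  inj : ∀ x ∈ Icc 1 n, ∀ y ∈ Icc 1 n, ∀ x' ∈ Icc 1 n, ∀ y' ∈ Icc 1 n, x ≠ y → x' ≠ y' →
    τ x y = τ x' y' → (x = x' ∨ x = y' ∨ y = x' ∨ y = y') → x = x' ∧ y = y'

/-- Team `t` plays at `j` in the first slot or directly after another away match, so that it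
never travels from its own venue to `j` after the first slot. -/
def Good (n t j : ℕ) (τ : ℕ → ℕ → ℕ) : Prop :=
  τ j t = 1 ∨ ∃ x ∈ Icc 1 n, x ≠ t ∧ τ x t + 1 = τ j t

/-- The value of the objective `c` on the play vector of the schedule `τ`. -/
noncomputable def playSum (n : ℕ) (c : ℕ → ℕ → ℕ → ℝ) (τ : ℕ → ℕ → ℕ) : ℝ :=
  ∑ p ∈ (Icc 1 n).offDiag, c (τ p.1 p.2) p.1 p.2

/-- The objective `c` takes the same value on all good schedules. -/
def ConstOnGood (n t j : ℕ) (c : ℕ → ℕ → ℕ → ℝ) : Prop :=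
  ∀ τ τ', Sched n τ → Good n t j τ → Sched n τ' → Good n t j τ' → playSum n c τ = playSum n c τ'

/-- The matches of team `v` occupy every slot exactly once. -/
theorem Sched.sum_slots {n : ℕ} {τ : ℕ → ℕ → ℕ} (h : Sched n τ) {v : ℕ} (hv : v ∈ Icc 1 n) :
    ((((Icc 1 n).erase v) ×ˢ (univ : Finset Bool)).image
      (fun q => if q.2 then τ v q.1 else τ q.1 v) = Icc 1 (2 * n - 2)) ∧
    Set.InjOn (fun q : ℕ × Bool => if q.2 then τ v q.1 else τ q.1 v)
      (((Icc 1 n).erase v) ×ˢ (univ : Finset Bool) : Finset (ℕ × Bool)) := by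
  have hinj : Set.InjOn (fun q : ℕ × Bool => if q.2 then τ v q.1 else τ q.1 v)
      (((Icc 1 n).erase v) ×ˢ (univ : Finset Bool) : Finset (ℕ × Bool)) := by
    rintro ⟨x, b⟩ hx ⟨y, b'⟩ hy hxy
    simp only [coe_product, coe_univ, Set.mem_prod, mem_coe, mem_erase, Set.mem_univ,
      and_true] at hx hy
    have h1 := h.inj
    cases b <;> cases b' <;> simp only [Bool.false_eq_true, if_true, if_false] at hxy
    · have := h1 x hx.2 v hv y hy.2 v hv hx.1 hy.1 hxy (by simp)
      simp [this.1]
    · have := h1 x hx.2 v hv v hv y hy.2 hx.1 hy.1.symm hxy (by simp)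
      exact absurd this.1 hx.1
    · have := h1 v hv x hx.2 y hy.2 v hv hx.1.symm hy.1 hxy (by simp)
      exact absurd this.2 hx.1
    · have := h1 v hv x hx.2 v hv y hy.2 hx.1.symm hy.1.symm hxy (by simp)
      simp [this.2]
  refine ⟨eq_of_subset_of_card_le ?_ ?_, hinj⟩
  · intro k hk
    obtain ⟨⟨x, b⟩, hx, rfl⟩ := mem_image.1 hk
    simp only [mem_product, mem_erase, mem_univ, and_true] at hx
    cases b
    · simpa using h.range x hx.2 v hv hx.1
    · simpa using h.range v hv x hx.2 hx.1.symm
  · rw [card_image_of_injOn hinj, card_product, card_erase_of_mem hv]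
    simp
    omega

theorem Sched.sum_team {n : ℕ} {τ : ℕ → ℕ → ℕ} (h : Sched n τ) {v : ℕ} (hv : v ∈ Icc 1 n)
    (g : ℕ → ℝ) :
    ∑ y ∈ (Icc 1 n).erase v, (g (τ v y) + g (τ y v)) = ∑ k ∈ Icc 1 (2 * n - 2), g k := by
  obtain ⟨h1, h2⟩ := h.sum_slots hv
  rw [← h1, sum_image h2, sum_product]
  simp

theorem Sched.exists_match {n : ℕ} {τ : ℕ → ℕ → ℕ} (h : Sched n τ) {v k : ℕ}
    (hv : v ∈ Icc 1 n) (hk : k ∈ Icc 1 (2 * n - 2)) :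
    ∃ x ∈ Icc 1 n, x ≠ v ∧ (τ v x = k ∨ τ x v = k) := by
  rw [← (h.sum_slots hv).1] at hk
  obtain ⟨⟨x, b⟩, hx, rfl⟩ := mem_image.1 hk
  simp only [mem_product, mem_erase, mem_univ, and_true] at hx
  refine ⟨x, hx.2, hx.1, ?_⟩
  cases b <;> simp

theorem sum_offDiag_eq {n : ℕ} (g : ℕ → ℕ → ℝ) :
    ∑ p ∈ (Icc 1 n).offDiag, g p.1 p.2 = ∑ x ∈ Icc 1 n, ∑ y ∈ (Icc 1 n).erase x, g x y := by
  rw [sum_sigma']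
  refine sum_bij' (fun p _ => ⟨p.1, p.2⟩) (fun p _ => (p.1, p.2)) ?_ ?_ ?_ ?_ ?_
  all_goals simp +contextual [eq_comm]

theorem sum_offDiag_swap {n : ℕ} (g : ℕ → ℕ → ℝ) :
    ∑ p ∈ (Icc 1 n).offDiag, g p.1 p.2 = ∑ p ∈ (Icc 1 n).offDiag, g p.2 p.1 := by
  refine sum_bij' (fun p _ => (p.2, p.1)) (fun p _ => (p.2, p.1)) ?_ ?_ ?_ ?_ ?_
  all_goals simp +contextual [eq_comm]

/-- An objective of the form `b (x, y) + u (k, x) + u (k, y)` is constant on schedules. -/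
theorem Sched.playSum_eq {n : ℕ} {τ : ℕ → ℕ → ℕ} (h : Sched n τ) (c : ℕ → ℕ → ℕ → ℝ)
    (b u : ℕ → ℕ → ℝ)
    (hc : ∀ k ∈ Icc 1 (2 * n - 2), ∀ x ∈ Icc 1 n, ∀ y ∈ Icc 1 n, x ≠ y →
      c k x y = b x y + (u k x + u k y)) :
    playSum n c τ = ∑ p ∈ (Icc 1 n).offDiag, b p.1 p.2 +
      ∑ x ∈ Icc 1 n, ∑ k ∈ Icc 1 (2 * n - 2), u k x := by
  have e1 : playSum n c τ = ∑ p ∈ (Icc 1 n).offDiag, b p.1 p.2 +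
      (∑ p ∈ (Icc 1 n).offDiag, u (τ p.1 p.2) p.1 +
        ∑ p ∈ (Icc 1 n).offDiag, u (τ p.1 p.2) p.2) := by
    rw [playSum, ← sum_add_distrib, ← sum_add_distrib]
    refine sum_congr rfl fun p hp => ?_
    rw [mem_offDiag] at hp
    exact hc _ (h.range _ hp.1 _ hp.2.1 hp.2.2) _ hp.1 _ hp.2.1 hp.2.2
  rw [e1, sum_offDiag_swap (fun x y => u (τ x y) y), sum_offDiag_eq (fun x y => u (τ x y) x),
    sum_offDiag_eq (fun x y => u (τ y x) x), ← sum_add_distrib]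
  congr 1
  refine sum_congr rfl fun x hx => ?_
  rw [← sum_add_distrib]
  exact h.sum_team hx (fun k => u k x)

/-- If all alternating sums along 4-cycles vanish, an edge function comes from vertex potentials. -/
theorem exists_potential {n : ℕ} (hn : 4 ≤ n) (D : ℕ → ℕ → ℝ)
    (hs : ∀ x ∈ Icc 1 n, ∀ y ∈ Icc 1 n, x ≠ y → D x y = D y x)
    (hD : ∀ a ∈ Icc 1 n, ∀ b ∈ Icc 1 n, ∀ c ∈ Icc 1 n, ∀ d ∈ Icc 1 n, [a, b, c, d].Nodup →
      D a b + D c d = D b c + D d a) :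
    ∃ v : ℕ → ℝ, ∀ x ∈ Icc 1 n, ∀ y ∈ Icc 1 n, x ≠ y → D x y = v x + v y := by
  have m1 : 1 ∈ Icc 1 n := by simp; omega
  have m2 : 2 ∈ Icc 1 n := by simp; omega
  have m3 : 3 ∈ Icc 1 n := by simp; omega
  have key : ∀ x ∈ Icc 1 n, ∀ y ∈ Icc 1 n, ∀ z ∈ Icc 1 n, x ≠ 1 → y ≠ 1 → z ≠ 1 → x ≠ y →
      y ≠ z → x ≠ z → D x y - D 1 x - D 1 y = D y z - D 1 y - D 1 z := by
    intro x hx y hy z hz h1 h2 h3 h4 h5 h6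
    have := hD x hx y hy z hz 1 m1 (by simp; tauto)
    have := hs z hz 1 m1 h3
    linarith
  have const : ∀ x ∈ Icc 1 n, ∀ y ∈ Icc 1 n, x ≠ 1 → y ≠ 1 → x ≠ y →
      D x y - D 1 x - D 1 y = D 2 3 - D 1 2 - D 1 3 := by
    intro x hx y hy h1 h2 h3
    have s1 := hs x hx y hy h3
    by_cases hx2 : x = 2
    · subst hx2
      by_cases hy3 : y = 3
      · subst hy3; ring
      · have := key y hy 2 m2 3 m3 h2 h1 (by norm_num) h3.symm (by norm_num) hy3
        linarith
    by_cases hy2 : y = 2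
    · subst hy2
      by_cases hx3 : x = 3
      · subst hx3; linarith
      · have := key x hx 2 m2 3 m3 h1 h2 (by norm_num) h3 (by norm_num) hx3
        linarith
    have a1 := key x hx y hy 2 m2 h1 h2 (by norm_num) h3 hy2 hx2
    by_cases hy3 : y = 3
    · subst hy3
      have := hs 2 m2 3 m3 (by norm_num)
      linarith
    · have := key y hy 2 m2 3 m3 h2 (by norm_num) (by norm_num) hy2 (by norm_num) hy3
      linarith
  refine ⟨fun x => if x = 1 then (D 1 2 + D 1 3 - D 2 3) / 2
    else D 1 x - (D 1 2 + D 1 3 - D 2 3) / 2, ?_⟩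
  intro x hx y hy hxy
  by_cases h1 : x = 1
  · subst h1
    simp [hxy.symm]
  · by_cases h2 : y = 1
    · subst h2
      have := hs x hx 1 m1 hxy
      simp [h1]; linarith
    · have := const x hx y hy h1 h2 hxy
      simp only [h1, h2, if_false]; linarith

/-- A 1-factorization of the complete graph on `{1,…,n}` as a proper edge colouring. -/
structure OneFact (n m : ℕ) (col : ℕ → ℕ → ZMod m) : Prop where
  symm : ∀ x ∈ Icc 1 n, ∀ y ∈ Icc 1 n, col x y = col y x
  inj : ∀ x ∈ Icc 1 n, ∀ y ∈ Icc 1 n, ∀ z ∈ Icc 1 n, x ≠ y → x ≠ z → col x y = col x z → y = z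
  surj : ∀ x ∈ Icc 1 n, ∀ γ, ∃ y ∈ Icc 1 n, y ≠ x ∧ col x y = γ

/-- A finite type can be enumerated by a finset of the same size with prescribed values. -/
theorem exists_enum {α : Type*} [Fintype α] (t : Finset ℕ) (hcard : Fintype.card α = #t)
    (L : List (α × ℕ)) (h1 : (L.map Prod.fst).Nodup) (h2 : (L.map Prod.snd).Nodup)
    (h3 : ∀ p ∈ L, p.2 ∈ t) :
    ∃ g : α → ℕ, Function.Injective g ∧ (∀ a, g a ∈ t) ∧ (∀ k ∈ t, ∃ a, g a = k) ∧
      ∀ p ∈ L, g p.1 = p.2 := by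
  induction L with
  | nil =>
    have e : α ≃ t := Fintype.equivOfCardEq (by simpa using hcard)
    refine ⟨fun a => e a, fun a b hab => e.injective (Subtype.ext hab), fun a => (e a).2,
      fun k hk => ⟨e.symm ⟨k, hk⟩, by simp⟩, by simp⟩
  | cons q L ih =>
    simp only [List.map_cons, List.nodup_cons] at h1 h2
    obtain ⟨g, gi, gt, gs, gL⟩ := ih h1.2 h2.2 (fun p hp => h3 p (by simp [hp]))
    obtain ⟨a, ha⟩ := gs q.2 (h3 q (by simp))
    refine ⟨g ∘ Equiv.swap a q.1, gi.comp (Equiv.injective _), fun x => gt _, fun k hk => ?_, ?_⟩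
    · obtain ⟨b, hb⟩ := gs k hk
      exact ⟨Equiv.swap a q.1 b, by simp [hb]⟩
    · intro p hp
      rcases List.mem_cons.1 hp with rfl | hp
      · simp [ha]
      · have hp1 : p.1 ≠ q.1 := fun h => h1.1 (h ▸ List.mem_map_of_mem hp)
        have hp2 : p.2 ≠ q.2 := fun h => h2.1 (h ▸ List.mem_map_of_mem hp)
        have hp3 : p.1 ≠ a := fun h => hp2 (by rw [← gL p hp, h, ha])
        simp [Equiv.swap_apply_of_ne_of_ne hp3 hp1, gL p hp]

/-- The edge colouring of the round-robin (circle) method. -/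
def circleCol (m : ℕ) : Option (ZMod m) → Option (ZMod m) → ZMod m
  | some x, some y => x + y
  | some x, none => 2 * x
  | none, some x => 2 * x
  | none, none => 0

theorem circleCol_comm (m : ℕ) (x y : Option (ZMod m)) : circleCol m x y = circleCol m y x := by
  cases x <;> cases y <;> simp [circleCol, add_comm]

theorem circleCol_inj {m : ℕ} {h : ZMod m} (hh : 2 * h = 1) {x y z : Option (ZMod m)}
    (hxy : x ≠ y) (hxz : x ≠ z) (he : circleCol m x y = circleCol m x z) : y = z := by
  have half : ∀ u v : ZMod m, 2 * u = 2 * v → u = v := fun u v huv => by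
    linear_combination h * huv + (v - u) * hh
  rcases x with _ | x <;> rcases y with _ | y <;> rcases z with _ | z <;>
    simp only [circleCol, ne_eq, not_true_eq_false, Option.some.injEq] at *
  · exact half _ _ he
  · exact absurd (by linear_combination he) hxz
  · exact absurd (by linear_combination -he) hxy
  · linear_combination he

theorem circleCol_surj {m : ℕ} {h : ZMod m} (hh : 2 * h = 1) (x : Option (ZMod m)) (γ : ZMod m) :
    ∃ y, y ≠ x ∧ circleCol m x y = γ := by
  rcases x with _ | x
  · exact ⟨some (h * γ), by simp, by simp only [circleCol]; linear_combination γ * hh⟩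
  · by_cases hx : γ = 2 * x
    · exact ⟨none, by simp, hx.symm⟩
    · refine ⟨some (γ - x), ?_, by simp [circleCol]⟩
      intro he
      exact hx (by linear_combination Option.some.inj he)

/-- There is a 1-factorization in which two given disjoint edges get the same colour. -/
theorem exists_oneFact {n m : ℕ} (hm : n = m + 1) (hn : 4 ≤ n) (heven : Even n) {a b c d : ℕ}
    (ha : a ∈ Icc 1 n) (hb : b ∈ Icc 1 n) (hc : c ∈ Icc 1 n) (hd : d ∈ Icc 1 n)
    (hnd : [a, b, c, d].Nodup) : ∃ col, OneFact n m col ∧ col a b = col c d := by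
  have : NeZero m := ⟨by omega⟩
  have : Fact (1 < m) := ⟨by omega⟩
  obtain ⟨r, hr⟩ := heven
  have hh : (2 : ZMod m) * (r : ZMod m) = 1 := by
    have : ((m + 1 : ℕ) : ZMod m) = ((r + r : ℕ) : ZMod m) := by rw [← hm, hr]
    push_cast at this
    rw [ZMod.natCast_self] at this
    linear_combination -this
  have hneg : (1 : ZMod m) ≠ -1 := by
    intro h
    have h2 : (2 : ZMod m) = 0 := by linear_combination h
    rw [h2, zero_mul] at hh
    exact zero_ne_one hh
  obtain ⟨g, gi, gt, gs, gL⟩ := exists_enum (α := Option (ZMod m)) (Icc 1 n)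
    (by simp [ZMod.card, hm]) [(none, a), (some 0, b), (some 1, c), (some (-1), d)]
    (by simp [hneg]) (by simpa using hnd) (by simp only [List.forall_mem_cons]; simp_all)
  simp only [List.forall_mem_cons] at gL
  have hex : ∀ k, ∃ e, k ∈ Icc 1 n → g e = k := fun k => by
    by_cases hk : k ∈ Icc 1 n
    · obtain ⟨e, he⟩ := gs k hk
      exact ⟨e, fun _ => he⟩
    · exact ⟨none, fun h => absurd h hk⟩
  choose e he using hex
  have eg : ∀ o, e (g o) = o := fun o => gi (he _ (gt o))
  have einj : ∀ x ∈ Icc 1 n, ∀ y ∈ Icc 1 n, e x = e y → x = y := fun x hx y hy h => by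
    rw [← he x hx, ← he y hy, h]
  refine ⟨fun x y => circleCol m (e x) (e y), ⟨fun x _ y _ => circleCol_comm _ _ _, ?_, ?_⟩, ?_⟩
  · intro x hx y hy z hz hxy hxz h
    exact einj y hy z hz (circleCol_inj hh (fun h => hxy (einj x hx y hy h))
      (fun h => hxz (einj x hx z hz h)) h)
  · intro x hx γ
    obtain ⟨o, ho, ho'⟩ := circleCol_surj hh (e x) γ
    refine ⟨g o, gt o, fun h => ho (by rw [← h, eg]), by simp only [eg, ho']⟩
  · rw [← gL.1, ← gL.2.1, ← gL.2.2.1, ← gL.2.2.2.1]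
    simp [eg, circleCol]

/-- The schedule of two 1-factorizations, the first oriented by `o` and the second against `o`. -/
noncomputable def double {m : ℕ} (o : ℕ → ℕ → Prop) (s : ZMod m ⊕ ZMod m → ℕ)
    (col col' : ℕ → ℕ → ZMod m) (x y : ℕ) : ℕ :=
  if o x y then s (.inl (col x y)) else s (.inr (col' x y))

theorem sched_double {n m : ℕ} {o : ℕ → ℕ → Prop}
    (ho : ∀ x y, x ≠ y → (o x y ↔ ¬ o y x)) {s : ZMod m ⊕ ZMod m → ℕ}
    (hs : Function.Injective s) (hr : ∀ e, s e ∈ Icc 1 (2 * n - 2))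
    {col col' : ℕ → ℕ → ZMod m} (h : OneFact n m col) (h' : OneFact n m col') :
    Sched n (double o s col col') := by
  refine ⟨fun x _ y _ _ => by unfold double; split_ifs <;> exact hr _, ?_⟩
  have same : ∀ col : ℕ → ℕ → ZMod m, OneFact n m col → ∀ x ∈ Icc 1 n, ∀ y ∈ Icc 1 n,
      ∀ x' ∈ Icc 1 n, ∀ y' ∈ Icc 1 n, x ≠ y → x' ≠ y' → col x y = col x' y' →
      (x = x' ∨ x = y' ∨ y = x' ∨ y = y') → (x = x' ∧ y = y') ∨ (x = y' ∧ y = x') := by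
    intro col h x hx y hy x' hx' y' hy' hxy hxy' he hsh
    have e1 := h.symm x hx y hy
    have e2 := h.symm x' hx' y' hy'
    rcases hsh with rfl | rfl | rfl | rfl
    · exact .inl ⟨rfl, h.inj x hx y hy y' hy' hxy hxy' he⟩
    · exact .inr ⟨rfl, h.inj x hx y hy x' hx' hxy hxy'.symm (he.trans e2)⟩
    · exact .inr ⟨h.inj y hy x hx y' hy' hxy.symm hxy' (e1.symm.trans he), rfl⟩
    · exact .inl ⟨h.inj y hy x hx x' hx' hxy.symm hxy'.symm (e1.symm.trans (he.trans e2)), rfl⟩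
  intro x hx y hy x' hx' y' hy' hxy hxy' he hsh
  have o1 := ho x y hxy
  unfold double at he
  split_ifs at he with h1 h2 h2
  · rcases same col h x hx y hy x' hx' y' hy' hxy hxy' (Sum.inl.inj (hs he)) hsh with h3 | h3
    · exact h3
    · rw [h3.1, h3.2] at o1 h1; tauto
  · exact absurd (hs he) (by simp)
  · exact absurd (hs he) (by simp)
  · rcases same col' h' x hx y hy x' hx' y' hy' hxy hxy' (Sum.inr.inj (hs he)) hsh with h3 | h3
    · exact h3
    · rw [h3.1, h3.2] at o1 h1; tauto

theorem playSum_sub {n : ℕ} (c : ℕ → ℕ → ℕ → ℝ) {τ τ' : ℕ → ℕ → ℕ} {E : Finset (ℕ × ℕ)}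
    (hE : E ⊆ (Icc 1 n).offDiag) (h : ∀ x y, (x, y) ∉ E → τ x y = τ' x y) :
    playSum n c τ - playSum n c τ' =
      ∑ p ∈ E, (c (τ p.1 p.2) p.1 p.2 - c (τ' p.1 p.2) p.1 p.2) := by
  rw [playSum, playSum, ← sum_sub_distrib]
  refine (sum_subset hE fun p _ hp => ?_).symm
  rw [h _ _ hp, sub_self]

/-- Exchange the slots of the two matches between `p` and `q`. -/
noncomputable def flip (p q : ℕ) (τ : ℕ → ℕ → ℕ) (x y : ℕ) : ℕ :=
  if (x = p ∧ y = q) ∨ (x = q ∧ y = p) then τ y x else τ x y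

theorem Sched.flip {n : ℕ} {τ : ℕ → ℕ → ℕ} (h : Sched n τ) (p q : ℕ) :
    Sched n (flip p q τ) := by
  refine ⟨fun x hx y hy hxy => ?_, ?_⟩
  · unfold TTP.flip; split_ifs
    · exact h.range y hy x hx hxy.symm
    · exact h.range x hx y hy hxy
  · intro x hx y hy x' hx' y' hy' hxy hxy' he hsh
    have a1 := h.inj x hx y hy x' hx' y' hy' hxy hxy'
    have a2 := h.inj y hy x hx x' hx' y' hy' hxy.symm hxy'
    have a3 := h.inj x hx y hy y' hy' x' hx' hxy hxy'.symm
    have a4 := h.inj y hy x hx y' hy' x' hx' hxy.symm hxy'.symm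
    unfold TTP.flip at he
    split_ifs at he <;> grind

theorem flip_rel {n : ℕ} {c : ℕ → ℕ → ℕ → ℝ} {τ : ℕ → ℕ → ℕ} {p q : ℕ}
    (hp : p ∈ Icc 1 n) (hq : q ∈ Icc 1 n) (hpq : p ≠ q)
    (he : playSum n c τ = playSum n c (flip p q τ)) :
    c (τ p q) p q + c (τ q p) q p = c (τ q p) p q + c (τ p q) q p := by
  have h := playSum_sub (n := n) c (τ := τ) (τ' := flip p q τ) (E := {(p, q), (q, p)})
    (by intro e he; simp only [mem_insert, mem_singleton] at he
        rcases he with rfl | rfl <;> simp [mem_offDiag] at * <;> omega)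
    (by intro x y hxy; simp only [mem_insert, mem_singleton, Prod.mk.injEq] at hxy
        simp [flip, hxy])
  rw [he, sub_self, sum_pair (by simp; omega)] at h
  simp [flip] at h
  linarith

/-- Exchange the slots `k` and `k'` on the pairs `E` (in slot `k`) and `E'` (in slot `k'`). -/
noncomputable def exchange (k k' : ℕ) (E E' : Finset (ℕ × ℕ)) (τ : ℕ → ℕ → ℕ) (x y : ℕ) : ℕ :=
  if (x, y) ∈ E then k' else if (x, y) ∈ E' then k else τ x y

theorem Sched.exchange {n : ℕ} {τ : ℕ → ℕ → ℕ} (h : Sched n τ) {k k' : ℕ} (hkk : k ≠ k')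
    {E E' : Finset (ℕ × ℕ)} (hE : E ⊆ (Icc 1 n).offDiag) (hE' : E' ⊆ (Icc 1 n).offDiag)
    (hk : ∀ p ∈ E, τ p.1 p.2 = k) (hk' : ∀ p ∈ E', τ p.1 p.2 = k')
    (hr : k ∈ Icc 1 (2 * n - 2)) (hr' : k' ∈ Icc 1 (2 * n - 2))
    (hcov : ∀ p ∈ E, ∀ v, v = p.1 ∨ v = p.2 → ∃ q ∈ E', v = q.1 ∨ v = q.2)
    (hcov' : ∀ p ∈ E', ∀ v, v = p.1 ∨ v = p.2 → ∃ q ∈ E, v = q.1 ∨ v = q.2) :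
    Sched n (exchange k k' E E' τ) := by
  refine ⟨fun x hx y hy hxy => ?_, ?_⟩
  · unfold TTP.exchange; split_ifs
    · exact hr'
    · exact hr
    · exact h.range x hx y hy hxy
  have key : ∀ x y, (x, y) ∈ E → ∀ x' ∈ Icc 1 n, ∀ y' ∈ Icc 1 n, x' ≠ y' → τ x' y' = k' →
      (x = x' ∨ x = y' ∨ y = x' ∨ y = y') → (x', y') ∈ E' := by
    intro x y hxy x' hx' y' hy' hne hs hsh
    obtain ⟨v, hv, hv'⟩ : ∃ v, (v = x ∨ v = y) ∧ (v = x' ∨ v = y') := by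
      rcases hsh with h | h | h | h
      · exact ⟨x, .inl rfl, .inl h⟩
      · exact ⟨x, .inl rfl, .inr h⟩
      · exact ⟨y, .inr rfl, .inl h⟩
      · exact ⟨y, .inr rfl, .inr h⟩
    obtain ⟨⟨a, b⟩, hq, hqv⟩ := hcov _ hxy v hv
    have hq' := mem_offDiag.1 (hE' hq)
    have hh := h.inj a hq'.1 b hq'.2.1 x' hx' y' hy' hq'.2.2 hne ((hk' _ hq).trans hs.symm)
      (by rcases hqv with rfl | rfl <;> tauto)
    rw [← hh.1, ← hh.2]; exact hq
  have key' : ∀ x y, (x, y) ∈ E' → ∀ x' ∈ Icc 1 n, ∀ y' ∈ Icc 1 n, x' ≠ y' → τ x' y' = k →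
      (x = x' ∨ x = y' ∨ y = x' ∨ y = y') → (x', y') ∈ E := by
    intro x y hxy x' hx' y' hy' hne hs hsh
    obtain ⟨v, hv, hv'⟩ : ∃ v, (v = x ∨ v = y) ∧ (v = x' ∨ v = y') := by
      rcases hsh with h | h | h | h
      · exact ⟨x, .inl rfl, .inl h⟩
      · exact ⟨x, .inl rfl, .inr h⟩
      · exact ⟨y, .inr rfl, .inl h⟩
      · exact ⟨y, .inr rfl, .inr h⟩
    obtain ⟨⟨a, b⟩, hq, hqv⟩ := hcov' _ hxy v hv
    have hq' := mem_offDiag.1 (hE hq)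
    have hh := h.inj a hq'.1 b hq'.2.1 x' hx' y' hy' hq'.2.2 hne ((hk _ hq).trans hs.symm)
      (by rcases hqv with rfl | rfl <;> tauto)
    rw [← hh.1, ← hh.2]; exact hq
  intro x hx y hy x' hx' y' hy' hxy hxy' he hsh
  have a := h.inj x hx y hy x' hx' y' hy' hxy hxy'
  have hsh' : x' = x ∨ x' = y ∨ y' = x ∨ y' = y := by
    rcases hsh with h | h | h | h <;> simp [h]
  unfold TTP.exchange at he
  split_ifs at he with h1 h2 h3 h4 h5 h6 h7 h8
  · exact a ((hk _ h1).trans (hk _ h2).symm) hsh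
  · exact absurd he.symm hkk
  · exact absurd (key x y h1 x' hx' y' hy' hxy' he.symm hsh) h3
  · exact absurd he hkk
  · exact a ((hk' _ h4).trans (hk' _ h6).symm) hsh
  · exact absurd (key' x y h4 x' hx' y' hy' hxy' he.symm hsh) h5
  · exact absurd (key x' y' h7 x hx y hy hxy he hsh') h4
  · exact absurd (key' x' y' h8 x hx y hy hxy he hsh') h1
  · exact a he hsh

/-- The relation given by exchanging the slots along an alternating 4-cycle. -/
theorem exchange_rel {n t j : ℕ} {c : ℕ → ℕ → ℕ → ℝ}
    (H : ConstOnGood n t j c) {τ : ℕ → ℕ → ℕ} (h : Sched n τ) (hg : Good n t j τ)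
    {k k' : ℕ} (hkk : k ≠ k') (hr : k ∈ Icc 1 (2 * n - 2)) (hr' : k' ∈ Icc 1 (2 * n - 2))
    {p q r s p' q' r' s' : ℕ} (hp : p ∈ Icc 1 n) (hq : q ∈ Icc 1 n) (hr1 : r ∈ Icc 1 n)
    (hs : s ∈ Icc 1 n) (hnd : [p, q, r, s].Nodup) (hperm : [p', q', r', s'].Perm [p, q, r, s])
    (h1 : τ p q = k) (h2 : τ r s = k) (h3 : τ p' q' = k') (h4 : τ r' s' = k')
    (hg' : Good n t j (exchange k k' {(p, q), (r, s)} {(p', q'), (r', s')} τ)) :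
    (c k p q - c k' p q) + (c k r s - c k' r s) =
      (c k p' q' - c k' p' q') + (c k r' s' - c k' r' s') := by
  have hnd' := hperm.nodup_iff.2 hnd
  have hm : ∀ v, (v = p' ∨ v = q' ∨ v = r' ∨ v = s') ↔ (v = p ∨ v = q ∨ v = r ∨ v = s) :=
    fun v => by simpa using hperm.mem_iff (a := v)
  have hV : ∀ v, (v = p ∨ v = q ∨ v = r ∨ v = s) → v ∈ Icc 1 n := by
    rintro v (rfl | rfl | rfl | rfl) <;> assumption
  have hp' := hV p' ((hm p').1 (by simp))
  have hq' := hV q' ((hm q').1 (by simp))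
  have hr1' := hV r' ((hm r').1 (by simp))
  have hs' := hV s' ((hm s').1 (by simp))
  simp only [List.nodup_cons, List.mem_cons, List.not_mem_nil, or_false, not_or] at hnd hnd'
  have hE : ({(p, q), (r, s)} : Finset (ℕ × ℕ)) ⊆ (Icc 1 n).offDiag := by
    intro e he
    simp only [mem_insert, mem_singleton] at he
    rcases he with rfl | rfl <;> rw [mem_offDiag] <;> tauto
  have hE' : ({(p', q'), (r', s')} : Finset (ℕ × ℕ)) ⊆ (Icc 1 n).offDiag := by
    intro e he
    simp only [mem_insert, mem_singleton] at he
    rcases he with rfl | rfl <;> rw [mem_offDiag] <;> tauto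
  have hx := h.exchange hkk hE hE' (by simp [h1, h2]) (by simp [h3, h4]) hr hr'
    (by
      intro e he v hv
      have := (hm v).2 (by simp only [mem_insert, mem_singleton] at he
                           rcases he with rfl | rfl <;> simp only at hv <;> tauto)
      simp; tauto)
    (by
      intro e he v hv
      have := (hm v).1 (by simp only [mem_insert, mem_singleton] at he
                           rcases he with rfl | rfl <;> simp only at hv <;> tauto)
      simp; tauto)
  have hd := playSum_sub (n := n) c (τ := τ)
    (τ' := exchange k k' {(p, q), (r, s)} {(p', q'), (r', s')} τ)
    (union_subset hE hE')
    (by intro x y hxy; rw [mem_union, not_or] at hxy; simp [exchange, hxy])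
  have hdis : ∀ e ∈ ({(p', q'), (r', s')} : Finset (ℕ × ℕ)),
      e ∉ ({(p, q), (r, s)} : Finset (ℕ × ℕ)) := by
    intro e he he'
    simp only [mem_insert, mem_singleton] at he he'
    apply hkk
    rcases he with rfl | rfl <;> rcases he' with he' | he' <;> rw [Prod.mk.injEq] at he' <;>
      simp only [he'.1, he'.2] at h3 h4 <;> omega
  rw [H _ _ h hg hx hg', sub_self, sum_union (disjoint_right.2 hdis),
    sum_pair (by simp; tauto), sum_pair (by simp; tauto)] at hd
  have n1 := hdis (p', q') (by simp)
  have n2 := hdis (r', s') (by simp)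
  simp only [exchange, n1, n2, mem_insert, mem_singleton, true_or, or_true, if_true, if_false,
    h1, h2, h3, h4] at hd
  linarith

/-- The orientation in which `t` always plays away. -/
def awayFor (t x y : ℕ) : Prop := y = t ∨ (x ≠ t ∧ x < y)

theorem awayFor_antisymm (t x y : ℕ) (h : x ≠ y) : awayFor t x y ↔ ¬ awayFor t y x := by
  unfold awayFor; omega

theorem double_away {m t x : ℕ} (s : ZMod m ⊕ ZMod m → ℕ) (col col' : ℕ → ℕ → ZMod m) :
    double (awayFor t) s col col' x t = s (.inl (col x t)) := by
  simp [double, awayFor]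

theorem double_cases {n m : ℕ} {o : ℕ → ℕ → Prop} (ho : ∀ x y, x ≠ y → (o x y ↔ ¬ o y x))
    (s : ZMod m ⊕ ZMod m → ℕ) {col col' : ℕ → ℕ → ZMod m} (h : OneFact n m col)
    (h' : OneFact n m col') {p q : ℕ} (hp : p ∈ Icc 1 n) (hq : q ∈ Icc 1 n) (hpq : p ≠ q) :
    (double o s col col' p q = s (.inl (col p q)) ∧
      double o s col col' q p = s (.inr (col' p q))) ∨
    (double o s col col' q p = s (.inl (col p q)) ∧
      double o s col col' p q = s (.inr (col' p q))) := by
  have h1 := ho p q hpq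
  by_cases h2 : o p q
  · left; simp [double, h2, h1.1 h2, h'.symm q hq p hp]
  · right; simp [double, h2, not_not.1 (mt h1.2 h2), h.symm q hq p hp]

theorem exists_fresh {n : ℕ} (hn : 4 ≤ n) (a b c : ℕ) :
    ∃ x ∈ Icc 1 n, x ≠ a ∧ x ≠ b ∧ x ≠ c := by
  obtain ⟨x, hx, hx'⟩ := exists_mem_notMem_of_card_lt_card (s := {a, b, c}) (t := Icc 1 n)
    (by have := card_le_three (a := a) (b := b) (c := c); simp; omega)
  exact ⟨x, hx, by simpa using hx'⟩

theorem exists_slots {n m : ℕ} (hm : n = m + 1) (hn : 4 ≤ n) (L : List ((ZMod m ⊕ ZMod m) × ℕ))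
    (h1 : (L.map Prod.fst).Nodup) (h2 : (L.map Prod.snd).Nodup)
    (h3 : ∀ p ∈ L, p.2 ∈ Icc 1 (2 * n - 2)) :
    ∃ s : ZMod m ⊕ ZMod m → ℕ, Function.Injective s ∧ (∀ e, s e ∈ Icc 1 (2 * n - 2)) ∧
      ∀ p ∈ L, s p.1 = p.2 := by
  have : NeZero m := ⟨by omega⟩
  obtain ⟨s, hs, hr, -, hL⟩ := exists_enum (α := ZMod m ⊕ ZMod m) (Icc 1 (2 * n - 2))
    (by simp [ZMod.card]; omega) L h1 h2 h3
  exact ⟨s, hs, hr, hL⟩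

/-- Two slots leave two consecutive other slots free. -/
theorem exists_consecutive {n : ℕ} (hn : 4 ≤ n) (k k' : ℕ) :
    ∃ l, 2 ≤ l ∧ l ≤ 2 * n - 2 ∧ l ≠ k ∧ l ≠ k' ∧ l - 1 ≠ k ∧ l - 1 ≠ k' := by
  by_cases h1 : k ≠ 1 ∧ k ≠ 2 ∧ k' ≠ 1 ∧ k' ≠ 2
  · exact ⟨2, by omega⟩
  by_cases h2 : k ≠ 3 ∧ k ≠ 4 ∧ k' ≠ 3 ∧ k' ≠ 4
  · exact ⟨4, by omega⟩
  · exact ⟨6, by omega⟩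

theorem OneFact.ne_of_ne {n m : ℕ} {col : ℕ → ℕ → ZMod m} (h : OneFact n m col) {x y t : ℕ}
    (ht : t ∈ Icc 1 n) (hx : x ∈ Icc 1 n) (hy : y ∈ Icc 1 n) (hxt : x ≠ t) (hyt : y ≠ t)
    (hxy : x ≠ y) : col x t ≠ col y t := by
  rw [h.symm x hx t ht, h.symm y hy t ht]
  exact fun he => hxy (h.inj t ht x hx y hy hxt.symm hyt.symm he)

theorem perm_of_pairs {p q r w p₁ q₁ r₁ w₁ : ℕ} (h : (p₁ = p ∧ q₁ = q) ∨ (p₁ = q ∧ q₁ = p))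
    (h' : (r₁ = r ∧ w₁ = w) ∨ (r₁ = w ∧ w₁ = r)) : [p₁, q₁, r₁, w₁].Perm [p, q, r, w] := by
  have aux : ∀ {p q p₁ q₁ : ℕ}, ((p₁ = p ∧ q₁ = q) ∨ (p₁ = q ∧ q₁ = p)) →
      [p₁, q₁].Perm [p, q] := by
    rintro p q _ _ (⟨rfl, rfl⟩ | ⟨rfl, rfl⟩)
    · exact List.Perm.refl _
    · exact List.Perm.swap _ _ _
  exact (aux h).append (aux h')

/-- Choose the orientation in which an edge is played in slot `k`. -/
theorem exists_directed {τ : ℕ → ℕ → ℕ} {c : ℕ → ℕ → ℕ → ℝ} {k a b p q : ℕ}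
    (hd : c a p q - c b p q = c a q p - c b q p) (h : τ p q = k ∨ τ q p = k) :
    ∃ p₁ q₁, ((p₁ = p ∧ q₁ = q) ∨ (p₁ = q ∧ q₁ = p)) ∧ τ p₁ q₁ = k ∧
      c a p₁ q₁ - c b p₁ q₁ = c a p q - c b p q := by
  rcases h with h | h
  · exact ⟨p, q, .inl ⟨rfl, rfl⟩, h, rfl⟩
  · exact ⟨q, p, .inr ⟨rfl, rfl⟩, h, hd.symm⟩

theorem exists_other_color {n m t j : ℕ} (hn : 4 ≤ n) (ht : t ∈ Icc 1 n) (hj : j ∈ Icc 1 n)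
    (htj : t ≠ j) {col : ℕ → ℕ → ZMod m} (hF : OneFact n m col) (γ : ZMod m) :
    ∃ x ∈ Icc 1 n, x ≠ t ∧ col x t ≠ col j t ∧ col x t ≠ γ := by
  obtain ⟨z, hz, hzt, hzj, -⟩ := exists_fresh hn t j j
  obtain ⟨y, hy, hyt, hyj, hyz⟩ := exists_fresh hn t j z
  by_cases h : col z t = γ
  · exact ⟨y, hy, hyt, hF.ne_of_ne ht hy hj hyt htj.symm hyj,
      h ▸ hF.ne_of_ne ht hy hz hyt hzt hyz⟩
  · exact ⟨z, hz, hzt, hF.ne_of_ne ht hz hj hzt htj.symm hzj, h⟩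

theorem venue_rel {n t j : ℕ} {c : ℕ → ℕ → ℕ → ℝ} (hn : 4 ≤ n) (heven : Even n)
    (ht : t ∈ Icc 1 n) (hj : j ∈ Icc 1 n) (htj : t ≠ j) (H : ConstOnGood n t j c)
    {p q k k' : ℕ} (hp : p ∈ Icc 1 n) (hq : q ∈ Icc 1 n) (hpq : p ≠ q)
    (hk : 1 ≤ k) (hkk : k + 2 ≤ k') (hk' : k' ≤ 2 * n - 2) :
    c k p q + c k' q p = c k' p q + c k q p := by
  obtain ⟨m, hm⟩ : ∃ m, n = m + 1 := ⟨n - 1, by omega⟩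
  obtain ⟨col, hF, -⟩ := exists_oneFact hm hn heven (a := 1) (b := 2) (c := 3) (d := 4)
    (by simp; omega) (by simp; omega) (by simp; omega) (by simp; omega) (by simp)
  suffices hs : ∃ s : ZMod m ⊕ ZMod m → ℕ, Function.Injective s ∧
      (∀ e, s e ∈ Icc 1 (2 * n - 2)) ∧ s (.inl (col p q)) = k ∧ s (.inr (col p q)) = k' ∧
      Good n t j (double (awayFor t) s col col) ∧
      Good n t j (flip p q (double (awayFor t) s col col)) by
    obtain ⟨s, s1, s2, s3, s4, g1, g2⟩ := hs
    have hS := sched_double (awayFor_antisymm t) s1 s2 hF hF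
    have hr := flip_rel hp hq hpq (H _ _ hS g1 (hS.flip p q) g2)
    rcases double_cases (awayFor_antisymm t) s hF hF hp hq hpq with ⟨e1, e2⟩ | ⟨e1, e2⟩ <;>
      rw [e1, e2, s3, s4] at hr <;> linarith
  have hpair : ∀ {x : ℕ}, x ∈ Icc 1 n → ((x = p ∧ t = q) ∨ (x = q ∧ t = p)) →
      col x t = col p q := by
    rintro x hx (⟨rfl, rfl⟩ | ⟨rfl, rfl⟩)
    · rfl
    · exact hF.symm _ hq _ hp
  by_cases hc : col j t = col p q
  · obtain ⟨x, hx, hxt, hxj, -⟩ := exists_fresh hn t j j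
    obtain ⟨y, hy, hyt, hyj, hyx⟩ := exists_fresh hn t j x
    have nx := hF.ne_of_ne ht hx hj hxt htj.symm hxj
    have ny := hF.ne_of_ne ht hy hj hyt htj.symm hyj
    have nxy := hF.ne_of_ne ht hy hx hyt hxt hyx
    rw [hc] at nx ny
    obtain ⟨s, s1, s2, s3, s4, s5, s6⟩ : ∃ s : ZMod m ⊕ ZMod m → ℕ, Function.Injective s ∧
        (∀ e, s e ∈ Icc 1 (2 * n - 2)) ∧ s (.inl (col p q)) = k ∧ s (.inr (col p q)) = k' ∧
        s (.inl (col x t)) = k' - 1 ∧ (k = 1 ∨ s (.inl (col y t)) = k - 1) := by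
      by_cases hk1 : k = 1
      · obtain ⟨s, s1, s2, s3⟩ := exists_slots hm hn
          [(.inl (col p q), k), (.inr (col p q), k'), (.inl (col x t), k' - 1)]
          (by simp [nx.symm]) (by simp; omega) (by simp; omega)
        simp only [List.forall_mem_cons] at s3
        exact ⟨s, s1, s2, s3.1, s3.2.1, s3.2.2.1, .inl hk1⟩
      · obtain ⟨s, s1, s2, s3⟩ := exists_slots hm hn
          [(.inl (col p q), k), (.inr (col p q), k'), (.inl (col x t), k' - 1),
            (.inl (col y t), k - 1)]
          (by simp [nx.symm, ny.symm, nxy.symm]) (by simp; omega) (by simp; omega)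
        simp only [List.forall_mem_cons] at s3
        exact ⟨s, s1, s2, s3.1, s3.2.1, s3.2.2.1, .inr s3.2.2.2.1⟩
    refine ⟨s, s1, s2, s3, s4, ?_, ?_⟩
    · unfold Good
      simp only [double_away, hc, s3]
      rcases s6 with h | h
      · exact .inl h
      · exact .inr ⟨y, hy, hyt, by rw [h]; omega⟩
    · by_cases hjt : (j = p ∧ t = q) ∨ (j = q ∧ t = p)
      · refine .inr ⟨x, hx, hxt, ?_⟩
        have e1 : double (awayFor t) s col col t j = s (.inr (col p q)) := by
          rcases double_cases (awayFor_antisymm t) s hF hF hj ht htj.symm with h | h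
          · rw [h.2, hc]
          · have := awayFor_antisymm t t j htj
            simp [double, awayFor, htj.symm, hF.symm t ht j hj, hc]
        rw [flip, if_neg (fun h => nx (hpair hx h)), flip, if_pos hjt, e1, double_away, s4, s5]
        omega
      · unfold Good
        rw [flip, if_neg hjt, double_away, hc, s3]
        rcases s6 with h | h
        · exact .inl h
        · refine .inr ⟨y, hy, hyt, ?_⟩
          rw [flip, if_neg (fun h => ny (hpair hy h)), double_away, h]; omega
  · obtain ⟨l, l1, l2, l3, l4, l5, l6⟩ := exists_consecutive hn k k'
    obtain ⟨x, hx, hxt, nxj, nxp⟩ := exists_other_color hn ht hj htj hF (col p q)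
    obtain ⟨s, s1, s2, s3⟩ := exists_slots hm hn
      [(.inl (col p q), k), (.inr (col p q), k'), (.inl (col j t), l), (.inl (col x t), l - 1)]
      (by simp [nxj.symm, nxp.symm, Ne.symm hc]) (by simp; omega) (by simp; omega)
    simp only [List.forall_mem_cons] at s3
    obtain ⟨s3, s4, s5, s6, -⟩ := s3
    refine ⟨s, s1, s2, s3, s4, .inr ⟨x, hx, hxt, ?_⟩, .inr ⟨x, hx, hxt, ?_⟩⟩
    · rw [double_away, double_away, s5, s6]; omega
    · rw [flip, if_neg (fun h => nxp (hpair hx h)), flip, if_neg (fun h => hc (hpair hj h)),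
        double_away, double_away, s5, s6]; omega

/-- The difference between two slots does not depend on the venue. -/
theorem slot_diff_comm {n t j : ℕ} {c : ℕ → ℕ → ℕ → ℝ} (hn : 4 ≤ n) (heven : Even n)
    (ht : t ∈ Icc 1 n) (hj : j ∈ Icc 1 n) (htj : t ≠ j) (H : ConstOnGood n t j c)
    {p q k k' : ℕ} (hp : p ∈ Icc 1 n) (hq : q ∈ Icc 1 n) (hpq : p ≠ q)
    (hk : k ∈ Icc 1 (2 * n - 2)) (hk' : k' ∈ Icc 1 (2 * n - 2)) :
    c k p q - c k' p q = c k q p - c k' q p := by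
  have R := fun k k' => venue_rel hn heven ht hj htj H (k := k) (k' := k') hp hq hpq
  have base : ∀ k ∈ Icc 1 (2 * n - 2), c k p q - c 1 p q = c k q p - c 1 q p := by
    intro k hk
    rw [mem_Icc] at hk
    rcases (show k = 1 ∨ k = 2 ∨ 3 ≤ k by omega) with rfl | rfl | h
    · ring
    · have := R 2 4 (by omega) (by omega) (by omega)
      have := R 1 4 (by omega) (by omega) (by omega)
      linarith
    · have := R 1 k (by omega) (by omega) (by omega)
      linarith
  linarith [base k hk, base k' hk']

theorem cycle_rel_of_good {n t j : ℕ} {c : ℕ → ℕ → ℕ → ℝ} (hn : 4 ≤ n) (heven : Even n)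
    (ht : t ∈ Icc 1 n) (hj : j ∈ Icc 1 n) (htj : t ≠ j) (H : ConstOnGood n t j c)
    {s : ZMod (n - 1) ⊕ ZMod (n - 1) → ℕ} {col col' : ℕ → ℕ → ZMod (n - 1)}
    (hF : OneFact n (n - 1) col) (hF' : OneFact n (n - 1) col')
    (s1 : Function.Injective s) (s2 : ∀ e, s e ∈ Icc 1 (2 * n - 2))
    {p q r w k k' : ℕ} (hp : p ∈ Icc 1 n) (hq : q ∈ Icc 1 n) (hr : r ∈ Icc 1 n)
    (hw : w ∈ Icc 1 n) (hnd : [p, q, r, w].Nodup)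
    (hk : k ∈ Icc 1 (2 * n - 2)) (hk' : k' ∈ Icc 1 (2 * n - 2)) (hkk : k ≠ k')
    (c1 : s (.inl (col p q)) = k) (c2 : s (.inl (col r w)) = k)
    (c3 : s (.inr (col' q r)) = k') (c4 : s (.inr (col' w p)) = k')
    {l : ℕ} (hl : double (awayFor t) s col col' j t = l)
    (hg : (l = 1 ∧ l ≠ k' ∧ (j, t) ∉ ({(p, q), (q, p), (r, w), (w, r)} : Finset (ℕ × ℕ))) ∨
      (l ≠ k ∧ l ≠ k' ∧ l - 1 ≠ k ∧ l - 1 ≠ k' ∧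
      ∃ x ∈ Icc 1 n, x ≠ t ∧ double (awayFor t) s col col' x t + 1 = l)) :
    (c k p q - c k' p q) + (c k r w - c k' r w) =
      (c k q r - c k' q r) + (c k w p - c k' w p) := by
  have hS := sched_double (awayFor_antisymm t) s1 s2 hF hF'
  obtain ⟨npq, nrw, nqr, nwp⟩ : p ≠ q ∧ r ≠ w ∧ q ≠ r ∧ w ≠ p := by
    simp only [List.nodup_cons, List.mem_cons, List.not_mem_nil, or_false, not_or] at hnd
    exact ⟨hnd.1.1, hnd.2.2.1, hnd.2.1.1, Ne.symm hnd.1.2.2⟩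
  have d1 := slot_diff_comm hn heven ht hj htj H hp hq npq hk hk'
  have d2 := slot_diff_comm hn heven ht hj htj H hr hw nrw hk hk'
  have d3 := slot_diff_comm hn heven ht hj htj H hq hr nqr hk hk'
  have d4 := slot_diff_comm hn heven ht hj htj H hw hp nwp hk hk'
  set τ := double (awayFor t) s col col' with hτ
  have hG : Good n t j τ := by
    rcases hg with h | h
    · exact .inl (by omega)
    · exact .inr (by rw [hl]; exact h.2.2.2.2)
  have hG' : ∀ E E' : Finset (ℕ × ℕ),
      (∀ e ∈ E, τ e.1 e.2 = k ∧ e ∈ ({(p, q), (q, p), (r, w), (w, r)} : Finset (ℕ × ℕ))) →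
      (∀ e ∈ E', τ e.1 e.2 = k') → Good n t j (exchange k k' E E' τ) := by
    intro E E' hE hE'
    have un : ∀ e : ℕ × ℕ, τ e.1 e.2 ≠ k → τ e.1 e.2 ≠ k' →
        exchange k k' E E' τ e.1 e.2 = τ e.1 e.2 := by
      intro e h1 h2
      rw [exchange, if_neg fun h => h1 (hE _ h).1, if_neg fun h => h2 (hE' _ h)]
    rcases hg with h | ⟨h1, h2, h3, h4, x, hx, hxt, h5⟩
    · left
      rw [exchange, if_neg fun h' => h.2.2 (hE _ h').2,
        if_neg fun h' => h.2.1 (hl.symm.trans (hE' _ h')), hl, h.1]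
    · right
      refine ⟨x, hx, hxt, ?_⟩
      rw [un (x, t) (by dsimp only; omega) (by dsimp only; omega),
        un (j, t) (by dsimp only; omega) (by dsimp only; omega), hl]
      exact h5
  have o : ∀ x ∈ Icc 1 n, ∀ y ∈ Icc 1 n, x ≠ y →
      (τ x y = s (.inl (col x y)) ∨ τ y x = s (.inl (col x y))) ∧
      (τ x y = s (.inr (col' x y)) ∨ τ y x = s (.inr (col' x y))) := by
    intro x hx y hy hxy
    rcases double_cases (awayFor_antisymm t) s hF hF' hx hy hxy with h | h
    · exact ⟨.inl h.1, .inr h.2⟩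
    · exact ⟨.inr h.1, .inl h.2⟩
  obtain ⟨p₁, q₁, a1, b1, e1⟩ := exists_directed d1
    (c1 ▸ (o p hp q hq npq).1)
  obtain ⟨r₁, w₁, a2, b2, e2⟩ := exists_directed d2
    (c2 ▸ (o r hr w hw nrw).1)
  obtain ⟨q₂, r₂, a3, b3, e3⟩ := exists_directed d3
    (c3 ▸ (o q hq r hr nqr).2)
  obtain ⟨w₂, p₂, a4, b4, e4⟩ := exists_directed d4
    (c4 ▸ (o w hw p hp nwp).2)
  have hP := perm_of_pairs a1 a2
  have hP' := (perm_of_pairs a3 a4).trans (List.perm_append_comm (l₁ := [q, r, w]) (l₂ := [p]))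
  have hV : ∀ v ∈ [p₁, q₁, r₁, w₁], v ∈ Icc 1 n := by
    intro v hv
    have := hP.mem_iff.1 hv
    simp only [List.mem_cons, List.not_mem_nil, or_false] at this
    rcases this with rfl | rfl | rfl | rfl <;> assumption
  rw [← e1, ← e2, ← e3, ← e4]
  refine exchange_rel H hS hG hkk hk hk' (hV p₁ (by simp)) (hV q₁ (by simp)) (hV r₁ (by simp))
    (hV w₁ (by simp)) (hP.nodup_iff.2 hnd) (hP'.trans hP.symm) b1 b2 b3 b4 (hG' _ _ ?_ ?_)
  · intro e he
    simp only [mem_insert, mem_singleton] at he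
    rcases he with rfl | rfl
    · exact ⟨b1, by rcases a1 with ⟨rfl, rfl⟩ | ⟨rfl, rfl⟩ <;> simp⟩
    · exact ⟨b2, by rcases a2 with ⟨rfl, rfl⟩ | ⟨rfl, rfl⟩ <;> simp⟩
  · intro e he
    simp only [mem_insert, mem_singleton] at he
    rcases he with rfl | rfl <;> assumption

theorem cycle_rel_of_color_ne {n t j : ℕ} {c : ℕ → ℕ → ℕ → ℝ} (hn : 4 ≤ n) (heven : Even n)
    (ht : t ∈ Icc 1 n) (hj : j ∈ Icc 1 n) (htj : t ≠ j) (H : ConstOnGood n t j c)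
    {col col' : ℕ → ℕ → ZMod (n - 1)}
    (hF : OneFact n (n - 1) col) (hF' : OneFact n (n - 1) col')
    {p q r w k k' : ℕ} (hp : p ∈ Icc 1 n) (hq : q ∈ Icc 1 n) (hr : r ∈ Icc 1 n)
    (hw : w ∈ Icc 1 n) (hnd : [p, q, r, w].Nodup)
    (hk : k ∈ Icc 1 (2 * n - 2)) (hk' : k' ∈ Icc 1 (2 * n - 2)) (hkk : k ≠ k')
    (hcol : col p q = col r w) (hcol' : col' q r = col' w p) (hc : col j t ≠ col p q) :
    (c k p q - c k' p q) + (c k r w - c k' r w) =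
      (c k q r - c k' q r) + (c k w p - c k' w p) := by
  obtain ⟨l, l1, l2, l3, l4, l5, l6⟩ := exists_consecutive hn k k'
  obtain ⟨x, hx, hxt, nxj, nxp⟩ := exists_other_color hn ht hj htj hF (col p q)
  obtain ⟨s, s1, s2, s3⟩ := exists_slots (m := n - 1) (by omega) hn
    [(.inl (col p q), k), (.inr (col' q r), k'), (.inl (col j t), l), (.inl (col x t), l - 1)]
    (by simp [nxj.symm, nxp.symm, Ne.symm hc]) (by simp; omega) (by simp at hk hk' ⊢; omega)
  simp only [List.forall_mem_cons] at s3
  obtain ⟨s3, s4, s5, s6, -⟩ := s3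
  refine cycle_rel_of_good hn heven ht hj htj H hF hF' s1 s2 hp hq hr hw hnd hk hk' hkk s3
    (hcol ▸ s3) s4 (hcol' ▸ s4) (l := l) ?_ (.inr ⟨l3, l4, l5, l6, x, hx, hxt, ?_⟩)
  · rw [double_away, s5]
  · rw [double_away, s6]; omega

theorem cycle_rel {n t j : ℕ} {c : ℕ → ℕ → ℕ → ℝ} (hn : 4 ≤ n) (heven : Even n)
    (ht : t ∈ Icc 1 n) (hj : j ∈ Icc 1 n) (htj : t ≠ j) (H : ConstOnGood n t j c)
    {p q r w k' : ℕ} (hp : p ∈ Icc 1 n) (hq : q ∈ Icc 1 n) (hr : r ∈ Icc 1 n)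
    (hw : w ∈ Icc 1 n) (hnd : [p, q, r, w].Nodup) (hk' : k' ∈ Icc 1 (2 * n - 2)) :
    (c k' p q - c 1 p q) + (c k' r w - c 1 r w) =
      (c k' q r - c 1 q r) + (c k' w p - c 1 w p) := by
  by_cases hkk : 1 = k'
  · subst hkk; ring
  have h1 : 1 ∈ Icc 1 (2 * n - 2) := by simp; omega
  have hnd' : [q, r, w, p].Nodup :=
    (List.perm_append_comm (l₁ := [q, r, w]) (l₂ := [p])).nodup_iff.2 hnd
  obtain ⟨col, hF, hcol⟩ := exists_oneFact (m := n - 1) (by omega) hn heven hp hq hr hw hnd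
  obtain ⟨col', hF', hcol'⟩ := exists_oneFact (m := n - 1) (by omega) hn heven hq hr hw hp hnd'
  by_cases hc : col j t = col p q
  · by_cases he : (j, t) ∈ ({(p, q), (q, p), (r, w), (w, r)} : Finset (ℕ × ℕ))
    · have := cycle_rel_of_color_ne hn heven ht hj htj H hF' hF hq hr hw hp hnd' hk' h1
        (Ne.symm hkk) hcol' hcol.symm ?_
      · linarith
      · simp only [List.nodup_cons, List.mem_cons, List.not_mem_nil, or_false, not_or] at hnd
        obtain ⟨⟨n1, n2, n3⟩, ⟨n4, n5⟩, n6, -⟩ := hnd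
        intro h
        simp only [mem_insert, mem_singleton, Prod.mk.injEq] at he
        rcases he with ⟨rfl, rfl⟩ | ⟨rfl, rfl⟩ | ⟨rfl, rfl⟩ | ⟨rfl, rfl⟩
        · rw [hF'.symm _ hp _ hq] at h
          exact n2 (hF'.inj _ hq _ hp _ hr (Ne.symm n1) n4 h)
        · exact n2 (hF'.inj _ hq _ hp _ hr (Ne.symm n1) n4 h)
        · rw [hF'.symm _ hq _ hr] at h
          exact n5 (hF'.inj _ hr _ hw _ hq n6 (Ne.symm n4) h).symm
        · rw [hF'.symm _ hq _ hr, hF'.symm _ hw _ hr] at h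
          exact n5 (hF'.inj _ hr _ hw _ hq n6 (Ne.symm n4) h).symm
    · obtain ⟨s, s1, s2, s3⟩ := exists_slots (m := n - 1) (by omega) hn
        [(.inl (col p q), 1), (.inr (col' q r), k')] (by simp) (by simpa using hkk)
        (by simp at hk' ⊢; omega)
      simp only [List.forall_mem_cons] at s3
      obtain ⟨s3, s4, -⟩ := s3
      have := cycle_rel_of_good hn heven ht hj htj H hF hF' s1 s2 hp hq hr hw hnd h1 hk' hkk s3
        (hcol ▸ s3) s4 (hcol' ▸ s4) (l := 1) (by rw [double_away, hc, s3])
        (.inl ⟨rfl, hkk, he⟩)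
      linarith
  · have := cycle_rel_of_color_ne hn heven ht hj htj H hF hF' hp hq hr hw hnd h1 hk' hkk hcol
      hcol' hc
    linarith

/-- An objective that is constant on good schedules is constant on all schedules. -/
theorem playSum_const {n t j : ℕ} {c : ℕ → ℕ → ℕ → ℝ} (hn : 4 ≤ n) (heven : Even n)
    (ht : t ∈ Icc 1 n) (hj : j ∈ Icc 1 n) (htj : t ≠ j) (H : ConstOnGood n t j c)
    {τ τ' : ℕ → ℕ → ℕ} (h : Sched n τ) (h' : Sched n τ') :
    playSum n c τ = playSum n c τ' := by
  have h1 : 1 ∈ Icc 1 (2 * n - 2) := by simp; omega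
  have hv : ∀ k, ∃ v : ℕ → ℝ, k ∈ Icc 1 (2 * n - 2) → ∀ x ∈ Icc 1 n, ∀ y ∈ Icc 1 n, x ≠ y →
      c k x y - c 1 x y = v x + v y := by
    intro k
    by_cases hk : k ∈ Icc 1 (2 * n - 2)
    · obtain ⟨v, hv⟩ := exists_potential hn (fun x y => c k x y - c 1 x y)
        (fun x hx y hy hxy => slot_diff_comm hn heven ht hj htj H hx hy hxy hk h1)
        (fun a ha b hb d hd e he hnd => cycle_rel hn heven ht hj htj H ha hb hd he hnd hk)
      exact ⟨v, fun _ => hv⟩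
    · exact ⟨0, fun h => absurd h hk⟩
  choose u hu using hv
  have hc : ∀ k ∈ Icc 1 (2 * n - 2), ∀ x ∈ Icc 1 n, ∀ y ∈ Icc 1 n, x ≠ y →
      c k x y = c 1 x y + (u k x + u k y) := fun k hk x hx y hy hxy => by
    linarith [hu k hk x hx y hy hxy]
  rw [h.playSum_eq c (c 1) u hc, h'.playSum_eq c (c 1) u hc]

/-- There is a good schedule in which `r` plays away at `p` and at `q` in consecutive slots. -/
theorem exists_consecutive_away {n t j : ℕ} (hn : 4 ≤ n) (heven : Even n) (ht : t ∈ Icc 1 n)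
    (hj : j ∈ Icc 1 n) (htj : t ≠ j) {r p q : ℕ} (hr : r ∈ Icc 1 n) (hp : p ∈ Icc 1 n)
    (hq : q ∈ Icc 1 n) (hpr : p ≠ r) (hqr : q ≠ r) (hpq : p ≠ q) :
    ∃ τ, Sched n τ ∧ Good n t j τ ∧ τ q r = τ p r + 1 := by
  obtain ⟨m, hm⟩ : ∃ m, n = m + 1 := ⟨n - 1, by omega⟩
  obtain ⟨col, hF, -⟩ := exists_oneFact hm hn heven (a := 1) (b := 2) (c := 3) (d := 4)
    (by simp; omega) (by simp; omega) (by simp; omega) (by simp; omega) (by simp)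
  have npq := hF.ne_of_ne hr hp hq hpr hqr hpq
  by_cases hrt : r = t
  · subst hrt
    obtain ⟨x, hx, hxr, hxp, hxq⟩ := exists_fresh hn r p q
    obtain ⟨y, hy, hyr, hyp, hyq, hyj⟩ : ∃ y ∈ Icc 1 n, y ≠ r ∧ y ≠ p ∧ y ≠ q ∧
        (j = p ∨ j = q ∨ y = j) := by
      by_cases h : j = p ∨ j = q
      · exact ⟨x, hx, hxr, hxp, hxq, by tauto⟩
      · exact ⟨j, hj, htj.symm, by tauto, by tauto, by tauto⟩
    have n1 := hF.ne_of_ne hr hy hp hyr hpr hyp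
    have n2 := hF.ne_of_ne hr hy hq hyr hqr hyq
    obtain ⟨s, s1, s2, s3⟩ := exists_slots hm hn
      [(.inl (col p r), 1), (.inl (col q r), 2), (.inl (col y r), 3)]
      (by simp [npq, n1.symm, n2.symm]) (by simp) (by simp; omega)
    simp only [List.forall_mem_cons] at s3
    obtain ⟨s3, s4, s5, -⟩ := s3
    refine ⟨_, sched_double (awayFor_antisymm r) s1 s2 hF hF, ?_, ?_⟩
    · unfold Good
      simp only [double_away]
      rcases hyj with rfl | rfl | rfl
      · exact .inl s3
      · exact .inr ⟨p, hp, hpr, by rw [s3, s4]⟩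
      · exact .inr ⟨q, hq, hqr, by rw [s4, s5]⟩
    · rw [double_away, double_away, s3, s4]
  · have ho : ∀ x y, x ≠ y → ((y = t ∨ (x ≠ t ∧ (x = r ∨ (y ≠ r ∧ x < y)))) ↔
        ¬ (x = t ∨ (y ≠ t ∧ (y = r ∨ (x ≠ r ∧ y < x))))) := by omega
    obtain ⟨s, s1, s2, s3⟩ := exists_slots hm hn
      [(.inl (col j t), 1), (.inr (col p r), 2), (.inr (col q r), 3)]
      (by simp [npq]) (by simp) (by simp; omega)
    simp only [List.forall_mem_cons] at s3
    obtain ⟨s3, s4, s5, -⟩ := s3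
    refine ⟨_, sched_double ho s1 s2 hF hF, .inl ?_, ?_⟩
    · simp [double, s3]
    · simp [double, hrt, hpr, hqr, s4, s5]

/-- The set of matches of a schedule. -/
def games (n : ℕ) (τ : ℕ → ℕ → ℕ) : Set (ℕ × ℕ × ℕ) :=
  {m | m.2.1 ∈ Icc 1 n ∧ m.2.2 ∈ Icc 1 n ∧ m.2.1 ≠ m.2.2 ∧ τ m.2.1 m.2.2 = m.1}

theorem mem_games {n : ℕ} {τ : ℕ → ℕ → ℕ} {k x y : ℕ} :
    (k, x, y) ∈ games n τ ↔ x ∈ Icc 1 n ∧ y ∈ Icc 1 n ∧ x ≠ y ∧ τ x y = k := Iff.rfl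

theorem Sched.isTournament {n : ℕ} {τ : ℕ → ℕ → ℕ} (h : Sched n τ) :
    IsTournament n (games n τ) := by
  refine ⟨?_, ?_, ?_⟩
  · rintro ⟨k, x, y⟩ hm
    obtain ⟨hx, hy, hxy, rfl⟩ := mem_games.1 hm
    have hr := h.range x hx y hy hxy
    rw [mem_Icc] at hx hy hr
    exact ⟨hr.1, hr.2, hx.1, hx.2, hy.1, hy.2, hxy⟩
  · intro k hk hk' t ht ht'
    have hT : t ∈ Icc 1 n := mem_Icc.2 ⟨ht, ht'⟩
    obtain ⟨x, hx, hxt, hk⟩ := h.exists_match hT (mem_Icc.2 ⟨hk, hk'⟩)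
    have huniq : ∀ a b, a ∈ Icc 1 n → b ∈ Icc 1 n → a ≠ b → τ a b = k → (t = a ∨ t = b) →
        ∃! m : ℕ × ℕ × ℕ, m ∈ games n τ ∧ m.1 = k ∧ (t = m.2.1 ∨ t = m.2.2) := by
      intro a b ha hb hab hs ht
      refine ⟨(k, a, b), ⟨⟨ha, hb, hab, hs⟩, rfl, ht⟩, ?_⟩
      rintro ⟨k', x', y'⟩ ⟨hm, rfl, ht2⟩
      obtain ⟨hx', hy', hxy', hs'⟩ := mem_games.1 hm
      have := h.inj x' hx' y' hy' a ha b hb hxy' hab (hs'.trans hs.symm)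
        (by dsimp only at ht2; rcases ht with rfl | rfl <;> rcases ht2 with rfl | rfl <;> simp)
      rw [this.1, this.2]
    rcases hk with hk | hk
    · exact huniq t x hT hx hxt.symm hk (.inl rfl)
    · exact huniq x t hx hT hxt hk (.inr rfl)
  · intro x y hx hx' hy hy' hxy
    exact ⟨τ x y, ⟨mem_Icc.2 ⟨hx, hx'⟩, mem_Icc.2 ⟨hy, hy'⟩, hxy, rfl⟩,
      fun k hk => (mem_games.1 hk).2.2.2.symm⟩

theorem IsTournament.exists_sched {n : ℕ} {T : Set (ℕ × ℕ × ℕ)} (h : IsTournament n T) :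
    ∃ τ, Sched n τ ∧ T = games n τ := by
  have hex : ∀ x y, ∃ k, x ∈ Icc 1 n → y ∈ Icc 1 n → x ≠ y →
      (k, x, y) ∈ T ∧ ∀ k', (k', x, y) ∈ T → k' = k := by
    intro x y
    by_cases hxy : x ∈ Icc 1 n ∧ y ∈ Icc 1 n ∧ x ≠ y
    · obtain ⟨h1, h2, h3⟩ := hxy
      rw [mem_Icc] at h1 h2
      obtain ⟨k, hk, hk'⟩ := h.pair x y h1.1 h1.2 h2.1 h2.2 h3
      exact ⟨k, fun _ _ _ => ⟨hk, hk'⟩⟩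
    · exact ⟨0, fun h1 h2 h3 => absurd ⟨h1, h2, h3⟩ hxy⟩
  choose τ hτ using hex
  refine ⟨τ, ⟨?_, ?_⟩, ?_⟩
  · intro x hx y hy hxy
    have := h.subset _ (hτ x y hx hy hxy).1
    exact mem_Icc.2 ⟨this.1, this.2.1⟩
  · intro x hx y hy x' hx' y' hy' hxy hxy' he hsh
    have m1 := (hτ x y hx hy hxy).1
    have m2 := (hτ x' y' hx' hy' hxy').1
    rw [← he] at m2
    have hr := h.subset _ m1
    obtain ⟨v, hv, h1, h2⟩ : ∃ v ∈ Icc 1 n, (v = x ∨ v = y) ∧ (v = x' ∨ v = y') := by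
      rcases hsh with h | h | h | h
      · exact ⟨x, hx, .inl rfl, .inl h⟩
      · exact ⟨x, hx, .inl rfl, .inr h⟩
      · exact ⟨y, hy, .inr rfl, .inl h⟩
      · exact ⟨y, hy, .inr rfl, .inr h⟩
    rw [mem_Icc] at hv
    have := (h.slot_team (τ x y) hr.1 hr.2.1 v hv.1 hv.2).unique ⟨m1, rfl, h1⟩ ⟨m2, rfl, h2⟩
    simpa using this
  · ext ⟨k, x, y⟩
    rw [mem_games]
    constructor
    · intro hm
      obtain ⟨-, -, hx, hx', hy, hy', hxy⟩ := h.subset _ hm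
      have hX : x ∈ Icc 1 n := mem_Icc.2 ⟨hx, hx'⟩
      have hY : y ∈ Icc 1 n := mem_Icc.2 ⟨hy, hy'⟩
      exact ⟨hX, hY, hxy, ((hτ x y hX hY hxy).2 k hm).symm⟩
    · rintro ⟨hx, hy, hxy, rfl⟩
      exact (hτ x y hx hy hxy).1

theorem Sched.venue_eq {n : ℕ} {τ : ℕ → ℕ → ℕ} (h : Sched n τ) {x y : ℕ} (hx : x ∈ Icc 1 n)
    (hy : y ∈ Icc 1 n) (hxy : x ≠ y) : venue (games n τ) y (τ x y) = x := by
  have hex : ∃ i, ∃ j, (τ x y, i, j) ∈ games n τ ∧ (y = i ∨ y = j) :=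
    ⟨x, y, ⟨hx, hy, hxy, rfl⟩, .inr rfl⟩
  rw [venue, dif_pos hex]
  obtain ⟨j, hm, hv⟩ := hex.choose_spec
  obtain ⟨hi, hj, hij, hs⟩ := mem_games.1 hm
  exact (h.inj _ hi j hj x hx y hy hij hxy hs (by rcases hv with h | h <;> simp [← h])).1

theorem Sched.venue_zero {n : ℕ} {τ : ℕ → ℕ → ℕ} (h : Sched n τ) (v : ℕ) :
    venue (games n τ) v 0 = v := by
  rw [venue, dif_neg]
  rintro ⟨i, j, hm, -⟩
  have := (h.isTournament.subset _ hm).1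
  simp at this

theorem slot_of_venue {n : ℕ} {τ : ℕ → ℕ → ℕ} {v k i : ℕ}
    (he : venue (games n τ) v k = i) (hi : i ≠ v) : τ i v = k := by
  by_cases hex : ∃ i, ∃ j, (k, i, j) ∈ games n τ ∧ (v = i ∨ v = j)
  · rw [venue, dif_pos hex] at he
    obtain ⟨j, hm, hv⟩ := hex.choose_spec
    rw [he] at hm hv
    rcases hv with hv | hv
    · exact absurd hv.symm hi
    · rw [hv]; exact (mem_games.1 hm).2.2.2
  · rw [venue, dif_neg hex] at he
    exact absurd he.symm hi

theorem Sched.travel_eq_zero {n : ℕ} {τ : ℕ → ℕ → ℕ} (h : Sched n τ) {r p q : ℕ}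
    (hr : r ∈ Icc 1 n) (hp : p ∈ Icc 1 n) (hq : q ∈ Icc 1 n) (hpr : p ≠ r) (hqr : q ≠ r)
    (hs : τ p r + 1 = τ q r) :
    travel n (games n τ) (r, p, r) = 0 ∧ travel n (games n τ) (r, r, q) = 0 ∧
      travel n (games n τ) (r, q, p) = 0 := by
  refine ⟨if_neg ?_, if_neg ?_, if_neg ?_⟩ <;> rintro ⟨k, -, h1, h2⟩ <;> dsimp only at h1 h2
  · have e := slot_of_venue h1 hpr
    rw [← e, hs, h.venue_eq hq hr hqr] at h2
    exact hqr h2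
  · have e := slot_of_venue h2 hqr
    rw [show k = τ p r by omega, h.venue_eq hp hr hpr] at h1
    exact hpr h1
  · have e := slot_of_venue h1 hqr
    have e' := slot_of_venue h2 hpr
    omega

theorem exists_travel_eq_zero {n t j : ℕ} (hn : 4 ≤ n) (heven : Even n) (ht : t ∈ Icc 1 n)
    (hj : j ∈ Icc 1 n) (htj : t ≠ j) {e : ℕ × ℕ × ℕ} (he : IsTravelIdx n e) :
    ∃ τ, Sched n τ ∧ Good n t j τ ∧ travel n (games n τ) e = 0 := by
  obtain ⟨r, u, w⟩ := e
  obtain ⟨r1, r2, u1, u2, w1, w2, huw⟩ := he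
  dsimp only at *
  have hr : r ∈ Icc 1 n := mem_Icc.2 ⟨r1, r2⟩
  have hu : u ∈ Icc 1 n := mem_Icc.2 ⟨u1, u2⟩
  have hw : w ∈ Icc 1 n := mem_Icc.2 ⟨w1, w2⟩
  obtain ⟨x, hx, hxr, hxu, hxw⟩ := exists_fresh hn r u w
  by_cases hwr : w = r
  · subst hwr
    obtain ⟨τ, h1, h2, h3⟩ := exists_consecutive_away hn heven ht hj htj hr hu hx huw hxr hxu.symm
    exact ⟨τ, h1, h2, (h1.travel_eq_zero hr hu hx huw hxr h3.symm).1⟩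
  by_cases hur : u = r
  · subst hur
    obtain ⟨τ, h1, h2, h3⟩ := exists_consecutive_away hn heven ht hj htj hr hx hw hxr hwr hxw
    exact ⟨τ, h1, h2, (h1.travel_eq_zero hr hx hw hxr hwr h3.symm).2.1⟩
  · obtain ⟨τ, h1, h2, h3⟩ := exists_consecutive_away hn heven ht hj htj hr hw hu hwr hur huw.symm
    exact ⟨τ, h1, h2, (h1.travel_eq_zero hr hw hu hwr hur h3.symm).2.2⟩

instance finite_match (n : ℕ) : Finite {m : ℕ × ℕ × ℕ // IsMatch n m} := by
  refine Finite.of_injective (β := (Icc 0 (2 * n) ×ˢ Icc 0 n ×ˢ Icc 0 n : Finset (ℕ × ℕ × ℕ)))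
    (fun m => ⟨m.1, ?_⟩) fun a b h => Subtype.ext (by simpa using h)
  obtain ⟨m, h1, h2, h3, h4, h5, h6, -⟩ := m
  simp only [mem_product, mem_Icc]
  omega

instance finite_travelIdx (n : ℕ) : Finite {p : ℕ × ℕ × ℕ // IsTravelIdx n p} := by
  refine Finite.of_injective (β := (Icc 0 n ×ˢ Icc 0 n ×ˢ Icc 0 n : Finset (ℕ × ℕ × ℕ)))
    (fun m => ⟨m.1, ?_⟩) fun a b h => Subtype.ext (by simpa using h)
  obtain ⟨m, h1, h2, h3, h4, h5, h6, -⟩ := m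
  simp only [mem_product, mem_Icc]
  omega

theorem finrank_add_one_eq {V : Type*} [AddCommGroup V] [Module ℝ V] [FiniteDimensional ℝ V]
    {A B : Submodule ℝ V} (f : V →ₗ[ℝ] ℝ) (e : V) (hAB : A ≤ B) (hA : A ≤ LinearMap.ker f)
    (hB : ∃ v ∈ B, f v ≠ 0) (hBA : B ≤ A ⊔ ℝ ∙ e) :
    Module.finrank ℝ A + 1 = Module.finrank ℝ B := by
  obtain ⟨v, hv, hfv⟩ := hB
  have h1 : Module.finrank ℝ A < Module.finrank ℝ B :=
    Submodule.finrank_lt_finrank_of_lt (lt_of_le_of_ne hAB fun h => hfv (hA (h ▸ hv)))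
  have h2 := Submodule.finrank_mono hBA
  have h3 := Submodule.finrank_add_le_finrank_add_finrank A (ℝ ∙ e)
  have h4 : Module.finrank ℝ (ℝ ∙ e) ≤ 1 := by
    simpa using finrank_span_le_card (R := ℝ) ({e} : Set V)
  omega

/-- The unit vector of a match. -/
noncomputable def matchVec (n k x y : ℕ) : Pt n := (fun m => if m.1 = (k, x, y) then 1 else 0, 0)

theorem play_eq_sum {n : ℕ} {τ : ℕ → ℕ → ℕ} :
    ((fun m => play (games n τ) m.1, 0) : Pt n) =
      ∑ p ∈ (Icc 1 n).offDiag, matchVec n (τ p.1 p.2) p.1 p.2 := by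
  refine Prod.ext ?_ ?_
  · rw [Prod.fst_sum]
    ext ⟨⟨k, x, y⟩, hm⟩
    rw [Finset.sum_apply]
    have hxy : (x, y) ∈ (Icc 1 n).offDiag := by
      obtain ⟨-, -, h1, h2, h3, h4, h5⟩ := hm
      simp only [mem_offDiag, mem_Icc]
      exact ⟨⟨h1, h2⟩, ⟨h3, h4⟩, h5⟩
    rw [sum_eq_single (x, y)]
    · have := mem_offDiag.1 hxy
      simp only [play, matchVec, mem_games, Prod.mk.injEq, and_true]
      congr 1
      simp only [eq_iff_iff]
      exact ⟨fun h => h.2.2.2.symm, fun h => ⟨this.1, this.2.1, this.2.2, h.symm⟩⟩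
    · rintro ⟨x', y'⟩ - hne
      simp only [matchVec, Prod.mk.injEq]
      rw [if_neg]
      rintro ⟨-, rfl, rfl⟩
      exact hne rfl
    · exact fun h => absurd hxy h
  · rw [Prod.snd_sum]
    simp [matchVec]


/-- The point with play vector `χ(T)` and travel coordinates `y`. -/
noncomputable def schedPt (n : ℕ) (τ : ℕ → ℕ → ℕ) (y : ℕ × ℕ × ℕ → ℝ) : Pt n :=
  (fun m => play (games n τ) m.1, fun q => y q.1)

theorem schedPt_mem {n : ℕ} {τ : ℕ → ℕ → ℕ} (h : Sched n τ) {y : ℕ × ℕ × ℕ → ℝ}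
    (hy : ∀ q, y q = 0 ∨ y q = 1) (hle : ∀ q, IsTravelIdx n q → travel n (games n τ) q ≤ y q) :
    schedPt n τ y ∈ Ptt n :=
  subset_convexHull ℝ _ ⟨games n τ, h.isTournament, fun _ => rfl, fun q => hy q.1,
    fun q => hle q.1 q.2⟩

/-- The unit vector of a travel index. -/
noncomputable def travelVec (n : ℕ) (e : ℕ × ℕ × ℕ) : Pt n := (0, fun q => if q.1 = e then 1 else 0)

/-- The linear form `x_{1,j,t} - y_{t,t,j}`. -/
noncomputable def facetForm (n t j : ℕ) : Pt n →ₗ[ℝ] ℝ where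
  toFun z := xval z 1 j t - yval z t t j
  map_add' z w := by
    simp only [xval, yval]
    split_ifs <;> simp <;> ring
  map_smul' a z := by
    simp only [xval, yval]
    split_ifs <;> simp
    ring

theorem facetForm_schedPt {n t j : ℕ} (hn : 4 ≤ n) (ht : t ∈ Icc 1 n) (hj : j ∈ Icc 1 n)
    (htj : t ≠ j) (τ : ℕ → ℕ → ℕ) (y : ℕ × ℕ × ℕ → ℝ) :
    facetForm n t j (schedPt n τ y) = (if τ j t = 1 then 1 else 0) - y (t, t, j) := by
  rw [mem_Icc] at ht hj
  have h1 : IsMatch n (1, j, t) := ⟨le_rfl, by dsimp; omega, hj.1, hj.2, ht.1, ht.2, htj.symm⟩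
  have h2 : IsTravelIdx n (t, t, j) := ⟨ht.1, ht.2, ht.1, ht.2, hj.1, hj.2, htj⟩
  have h3 : (1, j, t) ∈ games n τ ↔ τ j t = 1 := by
    simp [mem_games, hj, ht, htj.symm]
  change xval _ _ _ _ - yval _ _ _ _ = _
  simp [xval, yval, h1, h2, schedPt, play, h3]

theorem travel_nonneg (n : ℕ) (T : Set (ℕ × ℕ × ℕ)) (q : ℕ × ℕ × ℕ) : 0 ≤ travel n T q := by
  unfold travel; split_ifs <;> norm_num

theorem travel_le_one (n : ℕ) (T : Set (ℕ × ℕ × ℕ)) (q : ℕ × ℕ × ℕ) : travel n T q ≤ 1 := by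
  unfold travel; split_ifs <;> norm_num

theorem Sched.travel_eq_one {n t j : ℕ} {τ : ℕ → ℕ → ℕ} (h : Sched n τ) (ht : t ∈ Icc 1 n)
    (hj : j ∈ Icc 1 n) (htj : t ≠ j) (hs : τ j t = 1) : travel n (games n τ) (t, t, j) = 1 := by
  have := h.venue_eq hj ht htj.symm
  rw [hs] at this
  exact if_pos ⟨0, Nat.zero_le _, h.venue_zero t, this⟩

/-- The travel coordinates with `y_{t,t,j} = x_{1,j,t}` and all others equal to `1`. -/
noncomputable def tightY (t j : ℕ) (τ : ℕ → ℕ → ℕ) (q : ℕ × ℕ × ℕ) : ℝ :=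
  if q = (t, t, j) ∧ τ j t ≠ 1 then 0 else 1

theorem tightY_eq_zero_or_one (t j : ℕ) (τ : ℕ → ℕ → ℕ) (q : ℕ × ℕ × ℕ) :
    tightY t j τ q = 0 ∨ tightY t j τ q = 1 := by
  unfold tightY; split_ifs <;> simp

theorem Good.travel_le_tightY {n t j : ℕ} {τ : ℕ → ℕ → ℕ} (hg : Good n t j τ) (h : Sched n τ)
    (ht : t ∈ Icc 1 n) (hj : j ∈ Icc 1 n) (htj : t ≠ j) (q : ℕ × ℕ × ℕ) :
    travel n (games n τ) q ≤ tightY t j τ q := by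
  unfold tightY
  split_ifs with hq
  · obtain ⟨rfl, h1⟩ := hq
    rcases hg with hg | ⟨x, hx, hxt, hs⟩
    · exact absurd hg h1
    · exact (h.travel_eq_zero ht hx hj hxt htj.symm hs).2.1.le
  · exact travel_le_one _ _ _

theorem facetForm_le {n t j : ℕ} (hn : 4 ≤ n) (ht : t ∈ Icc 1 n) (hj : j ∈ Icc 1 n)
    (htj : t ≠ j) {z : Pt n} (hz : z ∈ Ptt n) : facetForm n t j z ≤ 0 := by
  refine convexHull_min ?_ (convex_halfSpace_le (facetForm n t j).isLinear 0) hz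
  rintro z ⟨T, hT, hx, -, hy⟩
  obtain ⟨τ, h, rfl⟩ := hT.exists_sched
  have ht' := mem_Icc.1 ht
  have hj' := mem_Icc.1 hj
  have hidx : IsTravelIdx n (t, t, j) := ⟨ht'.1, ht'.2, ht'.1, ht'.2, hj'.1, hj'.2, htj⟩
  have hz : z = schedPt n τ fun q => if hq : IsTravelIdx n q then z.2 ⟨q, hq⟩ else 0 := by
    refine Prod.ext (funext hx) ?_
    ext q
    simp [schedPt, q.2]
  have hle := hy ⟨_, hidx⟩
  change facetForm n t j z ≤ 0
  rw [hz, facetForm_schedPt hn ht hj htj, dif_pos hidx, sub_nonpos]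
  refine le_trans ?_ hle
  split_ifs with h1
  · exact (h.travel_eq_one ht hj htj h1).ge
  · exact travel_nonneg _ _ _

/-- The face of `Ptt(n)` on which `x_{1,j,t} = y_{t,t,j}`. -/
def face (n t j : ℕ) : Set (Pt n) := {z ∈ Ptt n | facetForm n t j z = 0}

theorem Good.schedPt_mem_face {n t j : ℕ} {τ : ℕ → ℕ → ℕ} (hg : Good n t j τ) (hn : 4 ≤ n)
    (h : Sched n τ) (ht : t ∈ Icc 1 n) (hj : j ∈ Icc 1 n) (htj : t ≠ j) :
    schedPt n τ (tightY t j τ) ∈ face n t j := by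
  refine ⟨schedPt_mem h (tightY_eq_zero_or_one t j τ)
    fun q _ => hg.travel_le_tightY h ht hj htj q, ?_⟩
  rw [facetForm_schedPt hn ht hj htj]
  by_cases h1 : τ j t = 1 <;> simp [tightY, h1]

theorem travelVec_mem_face_span {n t j : ℕ} (hn : 4 ≤ n) (heven : Even n) (ht : t ∈ Icc 1 n)
    (hj : j ∈ Icc 1 n) (htj : t ≠ j) {e : ℕ × ℕ × ℕ} (he : IsTravelIdx n e) (hne : e ≠ (t, t, j)) :
    travelVec n e ∈ vectorSpan ℝ (face n t j) := by
  obtain ⟨τ, h, hg, h0⟩ := exists_travel_eq_zero hn heven ht hj htj he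
  have hmem : schedPt n τ (fun q => if q = e then 0 else tightY t j τ q) ∈ face n t j := by
    refine ⟨schedPt_mem h (fun q => ?_) fun q _ => ?_, ?_⟩
    · split_ifs
      · exact .inl rfl
      · exact tightY_eq_zero_or_one t j τ q
    · split_ifs with hq
      · rw [hq, h0]
      · exact hg.travel_le_tightY h ht hj htj q
    · rw [facetForm_schedPt hn ht hj htj, if_neg hne.symm]
      by_cases h1 : τ j t = 1 <;> simp [tightY, h1]
  have := vsub_mem_vectorSpan ℝ (hg.schedPt_mem_face hn h ht hj htj) hmem
  convert this using 1
  refine Prod.ext ?_ ?_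
  · simp [travelVec, schedPt]
  · ext q
    by_cases hq : q.1 = e <;> simp [travelVec, schedPt, hq, tightY, hne]

theorem snd_mem_of_travelVec_mem {n : ℕ} {W : Submodule ℝ (Pt n)}
    (h : ∀ e, IsTravelIdx n e → travelVec n e ∈ W) (y : {q : ℕ × ℕ × ℕ // IsTravelIdx n q} → ℝ) :
    ((0, y) : Pt n) ∈ W := by
  have := Fintype.ofFinite {q : ℕ × ℕ × ℕ // IsTravelIdx n q}
  have hy : ((0, y) : Pt n) = ∑ q, y q • travelVec n q.1 := by
    refine Prod.ext ?_ ?_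
    · simp [Prod.fst_sum, travelVec]
    · ext q
      simp [Prod.snd_sum, travelVec, Subtype.ext_iff.symm]
  rw [hy]
  exact W.sum_mem fun q _ => W.smul_mem _ (h _ q.2)

theorem vectorSpan_Ptt_le {n t j : ℕ} (hn : 4 ≤ n) (heven : Even n) (ht : t ∈ Icc 1 n)
    (hj : j ∈ Icc 1 n) (htj : t ≠ j) :
    vectorSpan ℝ (Ptt n) ≤ vectorSpan ℝ (face n t j) ⊔ ℝ ∙ travelVec n (t, t, j) := by
  set W := vectorSpan ℝ (face n t j) ⊔ ℝ ∙ travelVec n (t, t, j)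
  have hsnd : ∀ y, ((0, y) : Pt n) ∈ W := by
    refine snd_mem_of_travelVec_mem fun e he => ?_
    by_cases hne : e = (t, t, j)
    · rw [hne]
      exact Submodule.mem_sup_right (Submodule.mem_span_singleton_self _)
    · exact Submodule.mem_sup_left (travelVec_mem_face_span hn heven ht hj htj he hne)
  rw [Ptt, ← direction_affineSpan, affineSpan_convexHull, direction_affineSpan, vectorSpan_def,
    Submodule.span_le]
  rintro _ ⟨z, ⟨T, hT, hx, -, -⟩, z', ⟨T', hT', hx', -, -⟩, rfl⟩
  obtain ⟨τ, h, rfl⟩ := hT.exists_sched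
  obtain ⟨τ', h', rfl⟩ := hT'.exists_sched
  by_contra hnot
  obtain ⟨φ, hφ, hker⟩ := Submodule.exists_le_ker_of_notMem hnot
  have hφ0 : ∀ y, φ ((0, y) : Pt n) = 0 := fun y => hker (hsnd y)
  have hplay : ∀ (σ : ℕ → ℕ → ℕ) (w : Pt n), (∀ m, w.1 m = play (games n σ) m.1) →
      φ w = playSum n (fun k x y => φ (matchVec n k x y)) σ := by
    intro σ w hw
    have : w = (fun m => play (games n σ) m.1, 0) + (0, w.2) :=
      Prod.ext (by simpa using funext hw) (by simp)
    rw [this, map_add, hφ0, add_zero, play_eq_sum, map_sum]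
    rfl
  refine hφ ?_
  change φ (z - z') = 0
  rw [map_sub, sub_eq_zero, hplay τ z hx, hplay τ' z' hx']
  refine playSum_const hn heven ht hj htj (fun σ σ' hs hg hs' hg' => ?_) h h'
  rw [← hplay σ (schedPt n σ (tightY t j σ)) fun _ => rfl,
    ← hplay σ' (schedPt n σ' (tightY t j σ')) fun _ => rfl, ← sub_eq_zero, ← map_sub]
  exact hker (Submodule.mem_sup_left (vsub_mem_vectorSpan ℝ
    (hg.schedPt_mem_face hn hs ht hj htj) (hg'.schedPt_mem_face hn hs' ht hj htj)))

theorem face_vectorSpan_le_ker (n t j : ℕ) :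
    vectorSpan ℝ (face n t j) ≤ LinearMap.ker (facetForm n t j) := by
  rw [vectorSpan_def, Submodule.span_le]
  rintro _ ⟨z, ⟨-, hz⟩, z', ⟨-, hz'⟩, rfl⟩
  simp [hz, hz']

theorem exists_facetForm_ne_zero {n t j : ℕ} (hn : 4 ≤ n) (heven : Even n) (ht : t ∈ Icc 1 n)
    (hj : j ∈ Icc 1 n) (htj : t ≠ j) : ∃ v ∈ vectorSpan ℝ (Ptt n), facetForm n t j v ≠ 0 := by
  obtain ⟨x, hx, hxt, hxj, -⟩ := exists_fresh hn t j j
  obtain ⟨τ, h, hg, hs⟩ := exists_consecutive_away hn heven ht hj htj ht hx hj hxt htj.symm hxj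
  have h1 : τ j t ≠ 1 := by
    have := (mem_Icc.1 (h.range x hx t ht hxt)).1
    omega
  have hone : schedPt n τ (fun _ => 1) ∈ Ptt n :=
    schedPt_mem h (fun _ => .inr rfl) fun q _ => travel_le_one _ _ _
  refine ⟨_, vsub_mem_vectorSpan ℝ hone (hg.schedPt_mem_face hn h ht hj htj).1, ?_⟩
  rw [vsub_eq_sub, map_sub, facetForm_schedPt hn ht hj htj, facetForm_schedPt hn ht hj htj]
  simp [tightY, h1]

/-- the inequalities `x_{1,j,t} ≤ y_{t,t,j}` are facet-defining. -/
theorem travel_first_facet (n : ℕ) (hn : 4 ≤ n) (heven : Even n)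
    (t j : ℕ) (ht1 : 1 ≤ t) (htn : t ≤ n) (hj1 : 1 ≤ j) (hjn : j ≤ n) (htj : t ≠ j) :
    IsFacetLE (fun z : Pt n => xval z 1 j t - yval z t t j) 0 := by
  have ht : t ∈ Icc 1 n := mem_Icc.2 ⟨ht1, htn⟩
  have hj : j ∈ Icc 1 n := mem_Icc.2 ⟨hj1, hjn⟩
  refine ⟨fun z hz => facetForm_le hn ht hj htj hz, ?_⟩
  rw [adim, adim, direction_affineSpan, direction_affineSpan]
  exact finrank_add_one_eq (facetForm n t j) (travelVec n (t, t, j))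
    (vectorSpan_mono ℝ (Set.sep_subset _ _)) (face_vectorSpan_le_ker n t j)
    (exists_facetForm_ne_zero hn heven ht hj htj) (vectorSpan_Ptt_le hn heven ht hj htj)

end TTP
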